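/- arXiv:2211.02550 — 3 statements merged into one kernel-verified Lean document; each statement's English description precedes it below -/
import Mathlib

section
/- (Riordan's recurrence; Proposition 2) For every integer n ≥ 4, the number a(n) = b_{1,1}(n) of permutations π of {1,…,n} such that |π_{i+1} − π_i| ≠ 1 for all 1 ≤ i ≤ n−1 satisfies a(n) = (n+1)·a(n−1) − (n−2)·a(n−2) − (n−5)·a(n−3) + (n−3)·a(n−4), where the equation is read in the integers. -/
/-- The set of permutations `π` of `{0,…,n-1}` (equivalently `{1,…,n}`) such that
`|π (i+1) - π i| ≠ 1` for all valid indices `i`.  For `n = 0` this has exactly one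
element (the empty permutation). -/
def noSuccession (n : ℕ) : Finset (Equiv.Perm (Fin n)) :=
  Finset.univ.filter fun π =>
    ∀ i j : Fin n, (j : ℕ) = (i : ℕ) + 1 →
      |((π j : ℕ) : ℤ) - ((π i : ℕ) : ℤ)| ≠ 1

namespace Riordan

def bump (v x : ℕ) : ℕ := if x < v then x else x + 1

def flag : List ℕ → ℕ
  | a :: b :: _ => if a + 1 = b ∨ b + 1 = a then 1 else 0
  | _ => 0

def adj : List ℕ → ℕ
  | [] => 0
  | a :: l => flag (a :: l) + adj l

def brf (v : ℕ) : List ℕ → ℕ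
  | a :: b :: _ => if (a + 1 = b ∧ b = v) ∨ (b + 1 = a ∧ a = v) then 1 else 0
  | _ => 0

def br (v : ℕ) : List ℕ → ℕ
  | [] => 0
  | a :: l => brf v (a :: l) + br v l

lemma flag_le (l : List ℕ) : flag l ≤ 1 := by
  rcases l with _ | ⟨a, _ | ⟨b, l⟩⟩ <;> simp [flag]
  split_ifs <;> simp

lemma flag_map (v : ℕ) (l : List ℕ) : flag (l.map (bump v)) + brf v l = flag l := by
  rcases l with _ | ⟨a, _ | ⟨b, l⟩⟩ <;> simp [flag, brf]
  unfold bump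
  split_ifs <;> omega

lemma adj_map (v : ℕ) (l : List ℕ) : adj (l.map (bump v)) + br v l = adj l := by
  induction l with
  | nil => rfl
  | cons a l ih =>
    have := flag_map v (a :: l)
    simp only [List.map_cons] at this
    simp only [List.map_cons, adj, br]
    omega

lemma sum_brf (n : ℕ) (l : List ℕ) (h : ∀ x ∈ l, x < n) :
    ∑ v ∈ Finset.range (n + 1), brf v l = flag l := by
  rcases l with _ | ⟨a, _ | ⟨b, l⟩⟩ <;> simp [flag, brf]
  have ha := h a (by simp)
  have hb := h b (by simp)
  by_cases h1 : a + 1 = b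
  · rw [if_pos (Or.inl h1), Finset.card_eq_one]
    refine ⟨b, ?_⟩
    ext x; simp; omega
  · by_cases h2 : b + 1 = a
    · rw [if_pos (Or.inr h2), Finset.card_eq_one]
      refine ⟨a, ?_⟩
      ext x; simp; omega
    · rw [if_neg (by omega), Finset.card_eq_zero]
      ext x; simp; omega

lemma sum_br (n : ℕ) (l : List ℕ) (h : ∀ x ∈ l, x < n) :
    ∑ v ∈ Finset.range (n + 1), br v l = adj l := by
  induction l with
  | nil => simp [br, adj]
  | cons a l ih =>
    simp only [br, adj, Finset.sum_add_distrib]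
    rw [sum_brf n _ h, ih (fun x hx => h x (by simp [hx]))]

lemma brf_mem {v : ℕ} {l : List ℕ} (h : brf v l ≠ 0) : v ∈ l ∧ ∃ w ∈ l, w + 1 = v := by
  rcases l with _ | ⟨a, _ | ⟨b, l⟩⟩ <;> simp only [brf] at h
  · exact absurd rfl h
  · exact absurd rfl h
  have h := of_not_not (fun hc => h (if_neg hc))
  rcases h with ⟨h1, h2⟩ | ⟨h1, h2⟩
  · exact ⟨by simp [h2], a, by simp, by omega⟩
  · exact ⟨by simp [h2], b, by simp, by omega⟩

lemma br_mem {v : ℕ} {l : List ℕ} (h : br v l ≠ 0) : v ∈ l ∧ ∃ w ∈ l, w + 1 = v := by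
  induction l with
  | nil => simp [br] at h
  | cons a l ih =>
    by_cases h1 : brf v (a :: l) = 0
    · have h2 : br v l ≠ 0 := by simpa [br, h1] using h
      obtain ⟨h3, w, hw, h4⟩ := ih h2
      exact ⟨by simp [h3], w, by simp [hw], h4⟩
    · exact brf_mem h1

lemma br_le (v : ℕ) (l : List ℕ) (h : l.Nodup) : br v l ≤ 1 := by
  induction l with
  | nil => simp [br]
  | cons a l ih =>
    rw [List.nodup_cons] at h
    have ih' := ih h.2
    by_cases h2 : br v l = 0
    · simp only [br, h2]
      rcases l with _ | ⟨b, l⟩ <;> simp [brf]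
      split_ifs <;> simp
    · obtain ⟨h3, w, hw, h4⟩ := br_mem h2
      have : brf v (a :: l) = 0 := by
        rcases l with _ | ⟨b, l⟩ <;> simp only [brf]
        rw [if_neg]
        rintro (⟨h5, h6⟩ | ⟨h5, h6⟩)
        · apply h.1
          have : a = w := by omega
          rw [this]; exact hw
        · apply h.1
          rw [h6]; exact h3
      simp only [br, this]; omega

lemma br_head (u : ℕ) (l : List ℕ) (h : (u :: l).Nodup) :
    br u (u :: l) + br (u + 1) (u :: l) = flag (u :: l) := by
  rw [List.nodup_cons] at h
  have h1 : br u l = 0 := by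
    by_contra hc
    exact h.1 (br_mem hc).1
  have h2 : br (u + 1) l = 0 := by
    by_contra hc
    obtain ⟨_, w, hw, h4⟩ := br_mem hc
    have : w = u := by omega
    exact h.1 (this ▸ hw)
  simp only [br, h1, h2]
  rcases l with _ | ⟨b, l⟩ <;> simp only [brf, flag]
  by_cases h3 : u + 1 = b
  · rw [if_neg (by grind), if_pos (by grind), if_pos (by grind)]
  · by_cases h4 : b + 1 = u
    · rw [if_pos (by grind), if_neg (by grind), if_pos (by grind)]
    · rw [if_neg (by grind), if_neg (by grind), if_neg (by grind)]

/-- weight for lists whose first pair is an adjacency -/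
def hk (l : List ℕ) (k : ℕ) : ℤ := flag l * (adj l.tail).choose k

lemma choose_sub (a b k : ℕ) (c : ℕ) (hb : b ≤ 1) (h : c + b = a) :
    (c.choose (k + 1) : ℤ) = a.choose (k + 1) - b * (a - 1).choose k := by
  interval_cases b
  · simp at h; simp [h]
  · subst h
    simp [Nat.choose_succ_succ]

lemma choose_cons (l : List ℕ) (k : ℕ) :
    ((adj l).choose (k + 1) : ℤ) = (adj l.tail).choose (k + 1) + hk l k := by
  rcases l with _ | ⟨a, l⟩
  · simp [adj, hk, flag]
  · have := flag_le (a :: l)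
    simp only [adj, hk, List.tail_cons]
    interval_cases hf : flag (a :: l)
    · simp
    · rw [add_comm 1, Nat.choose_succ_succ]; push_cast; ring

lemma sum_map (n k : ℕ) (l : List ℕ) (h : ∀ x ∈ l, x < n) (hd : l.Nodup) :
    ∑ v ∈ Finset.range (n + 1), ((adj (l.map (bump v))).choose k : ℤ)
      = ((n : ℤ) + 1 - k) * (adj l).choose k := by
  rcases k with _ | k
  · simp
  · rw [Finset.sum_congr rfl (fun v _ => choose_sub (adj l) (br v l) k _ (br_le v l hd)
      (adj_map v l))]
    rw [Finset.sum_sub_distrib, ← Finset.sum_mul]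
    have := sum_br n l h
    have h2 : ∑ v ∈ Finset.range (n + 1), (br v l : ℤ) = adj l := by exact_mod_cast this
    rw [h2]
    have h3 : (adj l : ℤ) * (adj l - 1).choose k = (adj l).choose (k + 1) * (k + 1) := by
      rcases hm : adj l with _ | m
      · simp
      · have := Nat.add_one_mul_choose_eq m k
        simp only [Nat.add_sub_cancel]
        exact_mod_cast this
    rw [h3]
    simp
    ring

lemma sum_hk (n k : ℕ) (u : ℕ) (l : List ℕ) (h : ∀ x ∈ u :: l, x < n) (hd : (u :: l).Nodup) :
    ∑ v ∈ Finset.range (n + 1), hk (v :: (u :: l).map (bump v)) k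
      = 2 * (adj (u :: l)).choose k - (if k = 0 then 0 else hk (u :: l) (k - 1)) := by
  have hu := h u (by simp)
  have hflag : ∀ v, flag (v :: (u :: l).map (bump v)) = if v = u ∨ v = u + 1 then 1 else 0 := by
    intro v
    simp only [List.map_cons, flag, bump]
    split_ifs <;> omega
  have h1 : ∀ v ∈ Finset.range (n + 1), hk (v :: (u :: l).map (bump v)) k =
      (if v = u then ((adj ((u :: l).map (bump u))).choose k : ℤ) else 0) +
      (if v = u + 1 then ((adj ((u :: l).map (bump (u + 1)))).choose k : ℤ) else 0) := by
    intro v _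
    unfold hk
    rw [hflag]
    by_cases h1 : v = u
    · subst h1; simp
    · by_cases h2 : v = u + 1
      · subst h2; simp
      · simp [h1, h2]
  rw [Finset.sum_congr rfl h1, Finset.sum_add_distrib, Finset.sum_ite_eq', Finset.sum_ite_eq',
    if_pos (by simp; omega), if_pos (by simp; omega)]
  rcases k with _ | k
  · simp
  · rw [choose_sub _ _ k _ (br_le u (u :: l) hd) (adj_map u (u :: l)),
      choose_sub _ _ k _ (br_le (u + 1) (u :: l) hd) (adj_map (u + 1) (u :: l))]
    have h2 := br_head u l hd
    have h3 : (br u (u :: l) : ℤ) + br (u + 1) (u :: l) = flag (u :: l) := by exact_mod_cast h2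
    have h4 : (flag (u :: l) : ℤ) * (adj (u :: l) - 1).choose k = hk (u :: l) k := by
      have := flag_le (u :: l)
      simp only [adj, hk, List.tail_cons]
      interval_cases hf : flag (u :: l)
      · simp
      · simp
    simp only [Nat.add_sub_cancel, Nat.add_one_ne_zero, if_false]
    rw [← h4, ← h3]; ring

/-! ### Permutations -/

def lst {n : ℕ} (π : Equiv.Perm (Fin n)) : List ℕ := List.ofFn (fun i => (π i : ℕ))

def ins {n : ℕ} (p : Fin (n + 1) × Equiv.Perm (Fin n)) : Equiv.Perm (Fin (n + 1)) :=
  (finSuccEquiv' 0).trans ((Equiv.optionCongr p.2).trans (finSuccEquiv' p.1).symm)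

lemma ins_zero {n : ℕ} (p : Fin (n + 1) × Equiv.Perm (Fin n)) : ins p 0 = p.1 := by
  simp [ins]

lemma ins_succ {n : ℕ} (p : Fin (n + 1) × Equiv.Perm (Fin n)) (i : Fin n) :
    ins p i.succ = p.1.succAbove (p.2 i) := by
  have : finSuccEquiv' (0 : Fin (n + 1)) i.succ = some i := by
    simp
  simp [ins, this]

lemma ins_bij (n : ℕ) : Function.Bijective (ins (n := n)) := by
  rw [Fintype.bijective_iff_injective_and_card]
  refine ⟨?_, ?_⟩
  · rintro ⟨v, σ⟩ ⟨w, τ⟩ h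
    have h0 : v = w := by simpa [ins_zero] using congrArg (fun f => f 0) h
    subst h0
    congr 1
    ext i
    have := congrArg (fun f => f i.succ) h
    simp only [ins_succ] at this
    rw [Fin.succAbove_right_injective this]
  · simp [Fintype.card_perm, Nat.factorial_succ]

lemma lst_ins {n : ℕ} (v : Fin (n + 1)) (σ : Equiv.Perm (Fin n)) :
    lst (ins (v, σ)) = (v : ℕ) :: (lst σ).map (bump v) := by
  unfold lst
  rw [List.ofFn_succ, List.map_ofFn]
  rw [ins_zero]
  congr 2
  funext i
  rw [ins_succ]
  change ((v.succAbove (σ i) : Fin (n + 1)) : ℕ) = if (σ i : ℕ) < v then (σ i : ℕ) else σ i + 1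
  by_cases h : (σ i : ℕ) < v
  · rw [if_pos h, Fin.succAbove_of_castSucc_lt _ _ h]; rfl
  · rw [if_neg h, Fin.succAbove_of_le_castSucc _ _ (not_lt.1 h)]; rfl

lemma sum_perm (n : ℕ) (f : List ℕ → ℤ) :
    ∑ π : Equiv.Perm (Fin (n + 1)), f (lst π) =
      ∑ σ : Equiv.Perm (Fin n), ∑ v ∈ Finset.range (n + 1), f (v :: (lst σ).map (bump v)) := by
  rw [← (ins_bij n).sum_comp (fun π => f (lst π)), Fintype.sum_prod_type, Finset.sum_comm]
  refine Finset.sum_congr rfl fun σ _ => ?_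
  rw [Finset.sum_range]
  simp only [lst_ins]

lemma lst_lt {n : ℕ} (σ : Equiv.Perm (Fin n)) : ∀ x ∈ lst σ, x < n := by
  intro x hx
  simp only [lst, List.mem_ofFn] at hx
  obtain ⟨i, rfl⟩ := hx
  exact (σ i).2

lemma lst_nodup {n : ℕ} (σ : Equiv.Perm (Fin n)) : (lst σ).Nodup := by
  unfold lst
  rw [List.nodup_ofFn]
  intro i j h
  exact σ.injective (Fin.ext h)

def q (n k : ℕ) : ℤ := ∑ π : Equiv.Perm (Fin n), ((adj (lst π)).choose k : ℤ)
def c (n k : ℕ) : ℤ := ∑ π : Equiv.Perm (Fin n), hk (lst π) k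

lemma q_zero (n : ℕ) : q n 0 = n.factorial := by
  simp [q, Fintype.card_perm]

lemma q_rec (n k : ℕ) : q (n + 1) (k + 1) = ((n : ℤ) - k) * q n (k + 1) + c (n + 1) k := by
  unfold q c
  rw [Finset.sum_congr rfl fun (π : Equiv.Perm (Fin (n + 1))) _ => choose_cons (lst π) k,
    Finset.sum_add_distrib]
  congr 1
  rw [sum_perm n (fun l => ((adj l.tail).choose (k + 1) : ℤ)), Finset.mul_sum]
  refine Finset.sum_congr rfl fun σ _ => ?_
  simp only [List.tail_cons]
  rw [sum_map n (k + 1) _ (lst_lt σ) (lst_nodup σ)]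
  push_cast
  ring

lemma c_rec (n k : ℕ) :
    c (n + 2) k = 2 * q (n + 1) k - (if k = 0 then 0 else c (n + 1) (k - 1)) := by
  have h : c (n + 2) k = ∑ σ : Equiv.Perm (Fin (n + 1)),
      (2 * ((adj (lst σ)).choose k : ℤ) - (if k = 0 then 0 else hk (lst σ) (k - 1))) := by
    unfold c
    rw [sum_perm (n + 1) (fun l => hk l k)]
    refine Finset.sum_congr rfl fun σ _ => ?_
    have h1 := lst_lt σ
    have h2 := lst_nodup σ
    have h3 : (lst σ).length = n + 1 := by simp [lst]
    generalize lst σ = l at *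
    rcases l with _ | ⟨u, l⟩
    · simp at h3
    · exact sum_hk (n + 1) k u l h1 h2
  rw [h, Finset.sum_sub_distrib, ← Finset.mul_sum]
  unfold q c
  congr 1
  split_ifs <;> simp

lemma q_rec2 (n k : ℕ) : q (n + 2) (k + 1) =
    ((n : ℤ) + 1 - k) * q (n + 1) (k + 1) + q (n + 1) k + ((n : ℤ) + 1 - k) * q n k := by
  rw [q_rec (n + 1) k, c_rec]
  rcases k with _ | k
  · simp [q_zero, Nat.factorial_succ]; ring
  · have := q_rec n k
    simp only [Nat.add_one_ne_zero, if_false, Nat.add_sub_cancel]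
    push_cast
    rw [this]; ring

lemma adj_le (l : List ℕ) : adj l ≤ l.length := by
  induction l with
  | nil => simp [adj]
  | cons a l ih =>
    have := flag_le (a :: l)
    simp only [adj, List.length_cons]; omega

lemma adj_zero (l : List ℕ) :
    adj l = 0 ↔ l.IsChain (fun a b => ¬ (a + 1 = b ∨ b + 1 = a)) := by
  induction l with
  | nil => simp [adj]
  | cons a l ih =>
    rcases l with _ | ⟨b, l⟩
    · simp [adj, flag]
    · rw [List.isChain_cons_cons, ← ih, adj, Nat.add_eq_zero_iff]
      simp [flag]

lemma mem_iff {n : ℕ} (π : Equiv.Perm (Fin n)) : π ∈ noSuccession n ↔ adj (lst π) = 0 := by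
  rw [adj_zero, lst, List.isChain_ofFn]
  simp only [noSuccession, Finset.mem_filter, Finset.mem_univ, true_and]
  constructor
  · intro h i hi
    have := h ⟨i, by omega⟩ ⟨i + 1, hi⟩ rfl
    intro hc
    apply this
    rcases hc with hc | hc
    · rw [← hc]; simp
    · rw [← hc]; simp
  · rintro h ⟨i, hi⟩ ⟨j, hj⟩ hij hc
    simp only at hij
    subst hij
    have := h i hj
    apply this
    rcases (abs_eq (by norm_num)).1 hc with h | h <;> omega

lemma card_eq (n : ℕ) : ((noSuccession n).card : ℤ) =
    ∑ k ∈ Finset.range (n + 1), (-1) ^ k * q n k := by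
  simp only [q, Finset.mul_sum]
  rw [Finset.sum_comm]
  have : ∀ π : Equiv.Perm (Fin n), ∑ k ∈ Finset.range (n + 1),
      (-1 : ℤ) ^ k * ((adj (lst π)).choose k : ℤ) = if π ∈ noSuccession n then 1 else 0 := by
    intro π
    have h1 : adj (lst π) ≤ n := by simpa [lst] using adj_le (lst π)
    rw [← Finset.sum_subset (Finset.range_mono (Nat.succ_le_succ h1))]
    · rw [Int.alternating_sum_range_choose]
      simp only [mem_iff]
    · intro k _ hk
      rw [Finset.mem_range, not_lt] at hk
      rw [Nat.choose_eq_zero_of_lt (by omega)]; simp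
  rw [Finset.sum_congr rfl fun π _ => this π]
  simp

/-! ### Power series -/

open PowerSeries

lemma exists_Y : ∃ Y : ℤ⟦X⟧, (1 + X) * Y = X * (1 - X) := by
  have : IsUnit (1 + X : ℤ⟦X⟧) := by
    rw [PowerSeries.isUnit_iff_constantCoeff]; simp
  obtain ⟨u, hu⟩ := this
  refine ⟨((u⁻¹ : ℤ⟦X⟧ˣ) : ℤ⟦X⟧) * (X * (1 - X)), ?_⟩
  rw [← hu, ← mul_assoc]; simp

lemma X_dvd {Y : ℤ⟦X⟧} (hY : (1 + X) * Y = X * (1 - X)) : ∃ U : ℤ⟦X⟧, Y = X * U ∧ coeff 0 U = 1 := by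
  have h : Y = X * (1 - X - Y) := by linear_combination hY
  refine ⟨_, h, ?_⟩
  have h0 : coeff 0 Y = 0 := by rw [h]; simp
  simp at h0
  simp [h0]

lemma coeff_lt {Y : ℤ⟦X⟧} (hY : (1 + X) * Y = X * (1 - X)) (n m : ℕ) (h : n < m) :
    coeff n (Y ^ m) = 0 := by
  obtain ⟨U, rfl, _⟩ := X_dvd hY
  rw [mul_pow, coeff_X_pow_mul', if_neg (by omega)]

lemma coeff_self {Y : ℤ⟦X⟧} (hY : (1 + X) * Y = X * (1 - X)) (n : ℕ) :
    coeff n (Y ^ n) = 1 := by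
  obtain ⟨U, rfl, h⟩ := X_dvd hY
  rw [mul_pow, coeff_X_pow_mul', if_pos le_rfl]
  simp at h
  simp [h]

lemma coeff_rec {Y : ℤ⟦X⟧} (hY : (1 + X) * Y = X * (1 - X)) (n m : ℕ) :
    coeff (n + 2) (Y ^ (m + 1)) = - coeff (n + 1) (Y ^ (m + 1)) +
      coeff (n + 1) (Y ^ m) - coeff n (Y ^ m) := by
  have h : Y ^ (m + 1) = - (X * Y ^ (m + 1)) + X * Y ^ m - X * (X * Y ^ m) := by
    rw [pow_succ]; linear_combination Y ^ m * hY
  have := congrArg (coeff (n + 2)) h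
  simpa [coeff_succ_X_mul] using this

lemma q_diag (n : ℕ) : q (n + 1) (n + 1) = 0 := by
  induction n with
  | zero =>
    have : ∀ π : Equiv.Perm (Fin 1), adj (lst π) = 0 := by
      intro π; simp [lst, adj, flag]
    simp [q, this]
  | succ n ih =>
    rw [q_rec2, ih]; push_cast; ring

lemma q_eq {Y : ℤ⟦X⟧} (hY : (1 + X) * Y = X * (1 - X)) (n : ℕ) : ∀ m k : ℕ, m + k = n →
    q n k = (-1) ^ k * m.factorial * coeff n (Y ^ m) := by
  induction n using Nat.strong_induction_on with
  | _ n ih =>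
    intro m k hmk
    rcases k with _ | k
    · simp only [add_zero] at hmk
      subst hmk
      simp [q_zero, coeff_self hY]
    · rcases m with _ | m
      · have : n = k + 1 := by omega
        subst this
        simp [q_diag, coeff_one]
      · obtain rfl : n = (m + k) + 2 := by omega
        rw [q_rec2, ih (m + k + 1) (by omega) m (k + 1) (by omega),
          ih (m + k + 1) (by omega) (m + 1) k (by omega), ih (m + k) (by omega) m k rfl,
          coeff_rec hY, Nat.factorial_succ]
        push_cast
        ring

lemma card_eq2 {Y : ℤ⟦X⟧} (hY : (1 + X) * Y = X * (1 - X)) (n N : ℕ) (h : n ≤ N) :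
    ((noSuccession n).card : ℤ) =
      coeff n (∑ m ∈ Finset.range (N + 1), (m.factorial : ℤ⟦X⟧) * Y ^ m) := by
  have hc : ∀ m : ℕ, coeff n ((m.factorial : ℤ⟦X⟧) * Y ^ m) = (m.factorial : ℤ) * coeff n (Y ^ m) := by
    intro m
    rw [← map_natCast (C (R := ℤ)), coeff_C_mul]
  rw [map_sum, Finset.sum_congr rfl fun m _ => hc m,
    ← Finset.sum_subset (Finset.range_mono (Nat.succ_le_succ h)), card_eq,
    ← Finset.sum_range_reflect]
  · refine Finset.sum_congr rfl fun m hm => ?_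
    rw [Finset.mem_range] at hm
    rw [q_eq hY n m (n + 1 - 1 - m) (by omega), ← mul_assoc, ← mul_assoc, ← mul_pow]
    simp
  · intro m _ hm
    rw [Finset.mem_range, not_lt] at hm
    rw [coeff_lt hY n m (by omega), mul_zero]

lemma ode {Y : ℤ⟦X⟧} (hY : (1 + X) * Y = X * (1 - X)) (N : ℕ) :
    X ^ 2 * (1 - X) ^ 2 * (1 + X) *
        derivative ℤ (∑ m ∈ Finset.range (N + 1), (m.factorial : ℤ⟦X⟧) * Y ^ m)
      - (1 - 2 * X - X ^ 2) * (1 + X ^ 2) *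
        (∑ m ∈ Finset.range (N + 1), (m.factorial : ℤ⟦X⟧) * Y ^ m)
      + (1 + X) * (1 - 2 * X - X ^ 2) =
    (1 + X) * (1 - 2 * X - X ^ 2) * (((N + 1).factorial : ℤ⟦X⟧) * Y ^ (N + 1)) := by
  have hd : (1 + X) * derivative ℤ Y + Y = 1 - 2 * X := by
    have := congrArg (derivative ℤ) hY
    simp only [Derivation.leibniz, map_add, map_sub, derivative_X, smul_eq_mul] at this
    simp at this
    linear_combination this
  have hd2 : (1 + X) ^ 2 * derivative ℤ Y = 1 - 2 * X - X ^ 2 := by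
    linear_combination (1 + X) * hd - hY
  induction N with
  | zero =>
    simp
    linear_combination (-(1 - 2 * X - X ^ 2)) * hY
  | succ N ih =>
    rw [Finset.sum_range_succ, map_add]
    have hf : derivative ℤ (((N + 1).factorial : ℤ⟦X⟧) * Y ^ (N + 1)) =
        ((N + 1).factorial : ℤ⟦X⟧) * ((N + 1 : ℤ⟦X⟧) * Y ^ N * derivative ℤ Y) := by
      rw [Derivation.leibniz, Derivation.leibniz_pow, Derivation.map_natCast]
      simp only [smul_eq_mul, nsmul_eq_mul, Nat.add_sub_cancel]
      push_cast
      ring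
    rw [hf, Nat.factorial_succ (N + 1)]
    push_cast
    generalize ((N + 1).factorial : ℤ⟦X⟧) = F at *
    generalize derivative ℤ Y = D at *
    have e1 : X ^ 2 * (1 - X) ^ 2 * (1 + X) * D = (1 + X) * Y ^ 2 * (1 - 2 * X - X ^ 2) := by
      linear_combination (1 + X) * Y ^ 2 * hd2 - (1 + X) * D * ((1 + X) * Y + X * (1 - X)) * hY
    linear_combination ih + F * (N + 1) * Y ^ N * e1 - F * Y ^ (N + 1) * (1 - 2 * X - X ^ 2) * hY

end Riordan

/-- Riordan's recurrence: for `n ≥ 4`, with `a(n) = b_{1,1}(n)`,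
`a(n) = (n+1)·a(n-1) - (n-2)·a(n-2) - (n-5)·a(n-3) + (n-3)·a(n-4)`,
read in the integers. -/
theorem riordan_recurrence (n : ℕ) (hn : 4 ≤ n) :
    ((noSuccession n).card : ℤ) =
      ((n : ℤ) + 1) * (noSuccession (n - 1)).card
        - ((n : ℤ) - 2) * (noSuccession (n - 2)).card
        - ((n : ℤ) - 5) * (noSuccession (n - 3)).card
        + ((n : ℤ) - 3) * (noSuccession (n - 4)).card := by
  obtain ⟨Y, hY⟩ := Riordan.exists_Y
  obtain ⟨n, rfl⟩ : ∃ k, n = k + 4 := ⟨n - 4, by omega⟩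
  rw [Riordan.card_eq2 hY (n + 4) (n + 4) le_rfl, Riordan.card_eq2 hY (n + 4 - 1) (n + 4) (by omega),
    Riordan.card_eq2 hY (n + 4 - 2) (n + 4) (by omega),
    Riordan.card_eq2 hY (n + 4 - 3) (n + 4) (by omega),
    Riordan.card_eq2 hY (n + 4 - 4) (n + 4) (by omega)]
  have h := Riordan.ode hY (n + 4)
  have hz : PowerSeries.coeff (n + 4) ((1 + PowerSeries.X) * (1 - 2 * PowerSeries.X -
      PowerSeries.X ^ 2) * (((n + 4 + 1).factorial : PowerSeries ℤ) * Y ^ (n + 4 + 1))) = 0 := by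
    obtain ⟨U, rfl, _⟩ := Riordan.X_dvd hY
    rw [mul_pow, mul_left_comm _ (PowerSeries.X ^ (n + 4 + 1)), mul_left_comm,
      PowerSeries.coeff_X_pow_mul', if_neg (by omega)]
  generalize (∑ m ∈ Finset.range (n + 4 + 1), (m.factorial : PowerSeries ℤ) * Y ^ m) = A at *
  rw [← h] at hz
  have e : ∀ D : PowerSeries ℤ, PowerSeries.X ^ 2 * (1 - PowerSeries.X) ^ 2 * (1 + PowerSeries.X) * D
      - (1 - 2 * PowerSeries.X - PowerSeries.X ^ 2) * (1 + PowerSeries.X ^ 2) * A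
      + (1 + PowerSeries.X) * (1 - 2 * PowerSeries.X - PowerSeries.X ^ 2) =
      PowerSeries.X ^ 2 * D - PowerSeries.X ^ 3 * D - PowerSeries.X ^ 4 * D + PowerSeries.X ^ 5 * D
      - A + PowerSeries.X ^ 1 * A + PowerSeries.X ^ 1 * A + PowerSeries.X ^ 3 * A
      + PowerSeries.X ^ 3 * A + PowerSeries.X ^ 4 * A
      + (1 - PowerSeries.X ^ 1 - PowerSeries.X ^ 2 - PowerSeries.X ^ 2
        - PowerSeries.X ^ 2 - PowerSeries.X ^ 3) := by
    intro D; ring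
  rw [e] at hz
  simp only [map_add, map_sub, PowerSeries.coeff_X_pow_mul', PowerSeries.coeff_X_pow,
    PowerSeries.coeff_one, PowerSeries.coeff_derivative] at hz
  rcases n with _ | n
  · simp at hz ⊢
    linarith
  · have a1 : n + 1 + 4 - 2 + 1 = n + 4 := by omega
    have a2 : n + 1 + 4 - 3 + 1 = n + 3 := by omega
    have a3 : n + 1 + 4 - 4 + 1 = n + 2 := by omega
    have a4 : n + 1 + 4 - 5 + 1 = n + 1 := by omega
    have b1 : n + 1 + 4 - 1 = n + 4 := by omega
    have b2 : n + 1 + 4 - 2 = n + 3 := by omega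
    have b3 : n + 1 + 4 - 3 = n + 2 := by omega
    have b4 : n + 1 + 4 - 4 = n + 1 := by omega
    have b5 : n + 1 + 4 - 5 = n := by omega
    rw [a1, a2, a3, a4] at hz
    simp only [b1, b2, b3, b4, b5] at hz ⊢
    rw [if_pos (by omega), if_pos (by omega), if_pos (by omega), if_pos (by omega),
      if_pos (by omega), if_pos (by omega), if_pos (by omega), if_neg (by omega),
      if_neg (by omega), if_neg (by omega), if_neg (by omega)] at hz
    push_cast at hz ⊢
    linear_combination -hz
end

section
/- (Lemma 2) For every integer n ≥ 3, b(n) = 2(n−1)·a(n−1) + 2·b(n−1) + b(n−2), where a(m) is the number of permutations of {1,…,m} with no violation and b(m) is the number of permutations of {1,…,m} with exactly one violation. -/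
/-- Index `i` is a violation of the permutation `π` of `{0,…,m-1}`
(equivalently `{1,…,m}`): `|π (i+1) - π i| = 1`. -/
def IsViolation (m : ℕ) (π : Equiv.Perm (Fin m)) (i : Fin m) : Prop :=
  ∃ j : Fin m, (j : ℕ) = (i : ℕ) + 1 ∧
    |((π j : ℕ) : ℤ) - ((π i : ℕ) : ℤ)| = 1

instance (m : ℕ) (π : Equiv.Perm (Fin m)) (i : Fin m) :
    Decidable (IsViolation m π i) := by unfold IsViolation; infer_instance

/-- The number of violations of `π`. -/
def violCount (m : ℕ) (π : Equiv.Perm (Fin m)) : ℕ :=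
  (Finset.univ.filter fun i : Fin m => IsViolation m π i).card

/-- The set of permutations of `{1,…,m}` with no violation, counted by `a(m)`. -/
def noViol (m : ℕ) : Finset (Equiv.Perm (Fin m)) :=
  Finset.univ.filter fun π => violCount m π = 0

/-- The set of permutations of `{1,…,m}` with exactly one violation, counted by `b(m)`. -/
def oneViol (m : ℕ) : Finset (Equiv.Perm (Fin m)) :=
  Finset.univ.filter fun π => violCount m π = 1

/-- The set of permutations of `{1,…,m}` with exactly one violation, occurring at the
last position `i = m - 1` (in `1`-based indexing, i.e. between the last two entries);
counted by `c(m)`. -/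
def oneViolLast (m : ℕ) : Finset (Equiv.Perm (Fin m)) :=
  Finset.univ.filter fun π => violCount m π = 1 ∧
    ∃ i : Fin m, (i : ℕ) + 2 = m ∧ IsViolation m π i

namespace Lem2

/-- `R π s i`: the consecutive entries at `i`, `i+1` go up by one (`s = true`)
or down by one (`s = false`). -/
def R {m : ℕ} (π : Equiv.Perm (Fin m)) (s : Bool) (i : ℕ) : Prop :=
  ∃ h : i + 1 < m, if s = true then (π ⟨i+1, h⟩ : ℕ) = π ⟨i, by omega⟩ + 1
    else (π ⟨i, by omega⟩ : ℕ) = π ⟨i+1, h⟩ + 1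

lemma isViolation_iff {m : ℕ} (π : Equiv.Perm (Fin m)) (i : Fin m) :
    IsViolation m π i ↔ ∃ s, R π s i := by
  unfold IsViolation R
  constructor
  · rintro ⟨j, hj, h⟩
    have hjm := j.2
    have him : (i : ℕ) + 1 < m := by omega
    obtain rfl : j = ⟨i+1, him⟩ := Fin.ext hj
    rw [abs_eq (by norm_num)] at h
    rcases h with h | h
    · exact ⟨true, by omega, by simp; omega⟩
    · exact ⟨false, by omega, by simp; omega⟩
  · rintro ⟨s, h, h'⟩
    refine ⟨⟨i+1, h⟩, rfl, ?_⟩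
    rw [abs_eq (by norm_num)]
    cases s <;> simp at h' <;> omega

lemma R_sign {m : ℕ} {π : Equiv.Perm (Fin m)} {s t : Bool} {i : ℕ}
    (h : R π s i) (h' : R π t i) : s = t := by
  obtain ⟨h1, h2⟩ := h
  obtain ⟨h3, h4⟩ := h'
  cases s <;> cases t <;> simp at h2 h4 ⊢ <;> omega

/-- `C π s p`: the only violation is at `p`, of sign `s`. -/
def C {m : ℕ} (π : Equiv.Perm (Fin m)) (s : Bool) (p : ℕ) : Prop :=
  R π s p ∧ ∀ s' i, R π s' i → s' = s ∧ i = p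

lemma mem_noViol {m : ℕ} (π : Equiv.Perm (Fin m)) :
    π ∈ noViol m ↔ ∀ s i, ¬ R π s i := by
  rw [noViol, Finset.mem_filter, violCount]
  simp only [Finset.mem_univ, true_and,
    Finset.card_eq_zero, Finset.filter_eq_empty_iff, isViolation_iff]
  constructor
  · intro h s i hR
    obtain ⟨h1, _⟩ := id hR
    exact h (x := ⟨i, by omega⟩) (by simp) ⟨s, hR⟩
  · rintro h i - ⟨s, hs⟩
    exact h _ _ hs

lemma mem_oneViol {m : ℕ} (π : Equiv.Perm (Fin m)) :
    π ∈ oneViol m ↔ ∃ s p, C π s p := by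
  rw [oneViol, Finset.mem_filter, violCount]
  simp only [Finset.mem_univ, true_and, Finset.mem_filter,
    Finset.card_eq_one, Finset.ext_iff, Finset.mem_singleton, isViolation_iff]
  constructor
  · rintro ⟨a, ha⟩
    obtain ⟨s, hs⟩ := (ha a).2 rfl
    refine ⟨s, a, hs, fun s' i hi => ?_⟩
    obtain ⟨h1, _⟩ := id hi
    have h2 := (ha ⟨i, by omega⟩).1 ⟨s', hi⟩
    have h3 : i = a := by rw [← h2]
    subst h3
    exact ⟨R_sign hi hs, rfl⟩
  · rintro ⟨s, p, h, h'⟩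
    obtain ⟨h1, _⟩ := id h
    refine ⟨⟨p, by omega⟩, fun a => ⟨?_, ?_⟩⟩
    · rintro ⟨t, ht⟩
      exact Fin.ext (h' _ _ ht).2
    · rintro rfl
      exact ⟨s, h⟩

/-- Insert value `v` at position `q`. -/
def ins {m : ℕ} (q v : Fin (m+1)) (σ : Equiv.Perm (Fin m)) : Equiv.Perm (Fin (m+1)) :=
  (finSuccEquiv' q).trans ((Equiv.optionCongr σ).trans (finSuccEquiv' v).symm)

lemma ins_at {m : ℕ} (q v : Fin (m+1)) (σ : Equiv.Perm (Fin m)) : ins q v σ q = v := by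
  simp [ins]

lemma ins_succAbove {m : ℕ} (q v : Fin (m+1)) (σ : Equiv.Perm (Fin m)) (i : Fin m) :
    ins q v σ (q.succAbove i) = v.succAbove (σ i) := by
  simp [ins]

lemma ins_inj {m : ℕ} {q v : Fin (m+1)} {σ τ : Equiv.Perm (Fin m)}
    (h : ins q v σ = ins q v τ) : σ = τ := by
  ext i
  have := ins_succAbove q v σ i
  rw [h, ins_succAbove] at this
  rw [Fin.succAbove_right_injective this]

lemma ins_surj {m : ℕ} (q : Fin (m+1)) (π : Equiv.Perm (Fin (m+1))) :
    ∃ σ, ins q (π q) σ = π := by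
  have key : ∀ i, ∃ j, (π q).succAbove j = π (q.succAbove i) := by
    intro i
    apply Fin.exists_succAbove_eq
    intro h
    exact Fin.succAbove_ne q i (π.injective h)
  choose f hf using key
  have hinj : Function.Injective f := by
    intro a b hab
    have := hf a
    rw [hab, hf b] at this
    exact (Fin.succAbove_right_injective (π.injective this)).symm
  refine ⟨Equiv.ofBijective f (Finite.injective_iff_bijective.1 hinj), ?_⟩
  ext j
  congr 1
  rcases Fin.eq_self_or_eq_succAbove q j with rfl | ⟨i, rfl⟩
  · rw [ins_at]
  · rw [ins_succAbove, ← hf i]; rfl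

lemma sA_val {m : ℕ} (v : Fin (m+1)) (x : Fin m) :
    (v.succAbove x : ℕ) = if (x : ℕ) < v then (x : ℕ) else x + 1 := by
  unfold Fin.succAbove
  simp only [Fin.lt_def]
  split_ifs with h1 h2 h2 <;> simp at h1 h2 ⊢ <;> omega

/-- Double the entry at `p`, into an up step or a down step. -/
def E {m : ℕ} (σ : Equiv.Perm (Fin m)) (p : Fin m) (s : Bool) : Equiv.Perm (Fin (m+1)) :=
  ins p.succ (if s = true then (σ p).succ else (σ p).castSucc) σ

lemma E_le {m : ℕ} (σ : Equiv.Perm (Fin m)) (p : Fin m) (s : Bool) (j : ℕ) (hj : j ≤ p)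
    (h : j < m + 1) : (E σ p s ⟨j, h⟩ : ℕ) =
      if (σ ⟨j, by omega⟩ : ℕ) < σ p + (if s = true then 1 else 0) then (σ ⟨j, by omega⟩ : ℕ)
      else σ ⟨j, by omega⟩ + 1 := by
  have e : (⟨j, h⟩ : Fin (m+1)) = p.succ.succAbove ⟨j, by omega⟩ := by
    ext; rw [sA_val]; simp; omega
  rw [e, E, ins_succAbove, sA_val]
  cases s <;> simp

lemma E_gt {m : ℕ} (σ : Equiv.Perm (Fin m)) (p : Fin m) (s : Bool) (j : ℕ) (hj : p < j)
    (h : j + 1 < m + 1) : (E σ p s ⟨j + 1, h⟩ : ℕ) =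
      if (σ ⟨j, by omega⟩ : ℕ) < σ p + (if s = true then 1 else 0) then (σ ⟨j, by omega⟩ : ℕ)
      else σ ⟨j, by omega⟩ + 1 := by
  have e : (⟨j+1, h⟩ : Fin (m+1)) = p.succ.succAbove ⟨j, by omega⟩ := by
    ext; rw [sA_val]; simp; omega
  rw [e, E, ins_succAbove, sA_val]
  cases s <;> simp

lemma E_eq {m : ℕ} (σ : Equiv.Perm (Fin m)) (p : Fin m) (s : Bool)
    (h : (p : ℕ) + 1 < m + 1) : (E σ p s ⟨p + 1, h⟩ : ℕ) =
      σ p + (if s = true then 1 else 0) := by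
  have e : (⟨p+1, h⟩ : Fin (m+1)) = p.succ := rfl
  rw [e, E, ins_at]
  cases s <;> simp

lemma R_E_at {m : ℕ} (σ : Equiv.Perm (Fin m)) (p : Fin m) (s : Bool) : R (E σ p s) s p := by
  refine ⟨by omega, ?_⟩
  rw [E_eq, E_le _ _ _ _ le_rfl]
  cases s <;> simp

lemma val_ne {m : ℕ} (σ : Equiv.Perm (Fin m)) (i j : ℕ) (hi : i < m) (hj : j < m) (h : i ≠ j) :
    (σ ⟨i, hi⟩ : ℕ) ≠ σ ⟨j, hj⟩ := by
  intro h'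
  have := σ.injective (Fin.ext h')
  exact h (by simpa using this)

/-- violations before the doubled entry -/
lemma R_E_lt {m : ℕ} (σ : Equiv.Perm (Fin m)) (p : Fin m) (s t : Bool) (j : ℕ) (hj : j < p) :
    R (E σ p s) t j ↔ R σ t j ∧ (t = s ∨ j + 1 < p) := by
  obtain ⟨p, hp⟩ := p
  simp only at hj
  have h1 := val_ne σ j p (by omega) (by omega) (by omega)
  have h3 := val_ne σ j (j+1) (by omega) (by omega) (by omega)
  unfold R
  rw [exists_prop_of_true (by omega), exists_prop_of_true (by omega),
    E_le _ _ _ _ (by simp; omega), E_le _ _ _ _ (by simp; omega)]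
  rcases eq_or_ne (j+1) p with rfl | hne
  · cases s <;> cases t <;> simp <;> split_ifs <;> omega
  · have h2 := val_ne σ (j+1) p (by omega) (by omega) (by omega)
    cases s <;> cases t <;> simp <;> split_ifs <;> omega

/-- violations after the doubled entry -/
lemma R_E_gt {m : ℕ} (σ : Equiv.Perm (Fin m)) (p : Fin m) (s t : Bool) (j : ℕ) (hj : p ≤ j) :
    R (E σ p s) t (j+1) ↔ R σ t j ∧ (t = s ∨ p < j) := by
  obtain ⟨p, hp⟩ := p
  simp only at hj
  by_cases hm : j + 1 < m
  · have h1 := val_ne σ (j+1) p (by omega) (by omega) (by omega)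
    have h3 := val_ne σ j (j+1) (by omega) (by omega) (by omega)
    unfold R
    rw [exists_prop_of_true (by omega), exists_prop_of_true (by omega),
      E_gt _ _ _ (j+1) (by simp; omega)]
    rcases eq_or_ne j p with rfl | hne
    · rw [E_eq σ ⟨j, hp⟩]
      cases s <;> cases t <;> simp <;> split_ifs <;> omega
    · have h2 := val_ne σ j p (by omega) (by omega) (by omega)
      rw [E_gt _ _ _ j (by simp; omega)]
      cases s <;> cases t <;> simp <;> split_ifs <;> omega
  · constructor
    · rintro ⟨h, _⟩; omega
    · rintro ⟨⟨h, _⟩, _⟩; omega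

lemma E_surj {m : ℕ} (π : Equiv.Perm (Fin (m+1))) (s : Bool) (p : ℕ) (hp : p < m) (h : R π s p) :
    ∃ σ, E σ ⟨p, hp⟩ s = π := by
  obtain ⟨σ, hσ⟩ := ins_surj (Fin.succ ⟨p, hp⟩) π
  refine ⟨σ, ?_⟩
  have hv : (if s = true then (σ ⟨p, hp⟩).succ else (σ ⟨p, hp⟩).castSucc)
      = π (Fin.succ ⟨p, hp⟩) := by
    obtain ⟨h1, h2⟩ := h
    have e : (⟨p, by omega⟩ : Fin (m+1)) = (Fin.succ ⟨p, hp⟩ : Fin (m+1)).succAbove ⟨p, hp⟩ := by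
      ext; simp [Fin.succAbove, Fin.lt_def]
    have e2 := ins_succAbove (Fin.succ ⟨p, hp⟩) (π (Fin.succ ⟨p, hp⟩)) σ ⟨p, hp⟩
    rw [hσ, ← e] at e2
    rw [e2] at h2
    have e3 : (⟨p+1, h1⟩ : Fin (m+1)) = Fin.succ ⟨p, hp⟩ := rfl
    rw [e3] at h2
    generalize π (Fin.succ ⟨p, hp⟩) = v at *
    ext
    cases s <;> simp [Fin.succAbove, Fin.lt_def] at h2 ⊢ <;> split_ifs at h2 <;>
      simp at h2 <;> omega
  rw [E, hv, hσ]

lemma E_inj {m : ℕ} {σ τ : Equiv.Perm (Fin m)} {p : Fin m} {s t : Bool}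
    (h : E σ p s = E τ p t) : σ = τ ∧ s = t := by
  have hs : s = t := R_sign (R_E_at σ p s) (h ▸ R_E_at τ p t)
  subst hs
  refine ⟨?_, rfl⟩
  have h1 := ins_at p.succ (if s = true then (σ p).succ else (σ p).castSucc) σ
  have h2 := ins_at p.succ (if s = true then (τ p).succ else (τ p).castSucc) τ
  unfold E at h
  rw [h, h2] at h1
  rw [h1] at h
  exact ins_inj h

/-- The doublings with exactly one violation. -/
def Good {m : ℕ} (σ : Equiv.Perm (Fin m)) (p : ℕ) (s : Bool) : Prop :=
  (∀ i, ¬ R σ s i) ∧ ∀ i, R σ (!s) i → i = p ∨ i + 1 = p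

lemma R_lt {m : ℕ} {σ : Equiv.Perm (Fin m)} {s : Bool} {i : ℕ} (h : R σ s i) : i + 1 < m := h.1

lemma good_of_C {m : ℕ} (σ : Equiv.Perm (Fin m)) (p : Fin m) (s : Bool)
    (h : E σ p s ∈ oneViol (m+1)) : Good σ p s := by
  obtain ⟨t, q, h1, h2⟩ := (mem_oneViol _).1 h
  obtain ⟨rfl, rfl⟩ := h2 _ _ (R_E_at σ p s)
  constructor
  · intro i hi
    rcases lt_or_ge i (p : ℕ) with hp | hp
    · have := (h2 _ _ ((R_E_lt σ p s s i hp).2 ⟨hi, Or.inl rfl⟩)).2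
      omega
    · have := (h2 _ _ ((R_E_gt σ p s s i hp).2 ⟨hi, Or.inl rfl⟩)).2
      omega
  · intro i hi
    by_contra hne
    rcases lt_or_ge i (p : ℕ) with hp | hp
    · have := (h2 _ _ ((R_E_lt σ p s _ i hp).2 ⟨hi, Or.inr (by omega)⟩)).2
      omega
    · have := (h2 _ _ ((R_E_gt σ p s _ i hp).2 ⟨hi, Or.inr (by omega)⟩)).2
      omega

lemma C_of_good {m : ℕ} (σ : Equiv.Perm (Fin m)) (p : Fin m) (s : Bool)
    (h : Good σ p s) : C (E σ p s) s p := by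
  refine ⟨R_E_at σ p s, fun t i hi => ?_⟩
  obtain ⟨h1, h2⟩ := h
  rcases lt_trichotomy i (p : ℕ) with hp | rfl | hp
  · exfalso
    obtain ⟨a, b⟩ := (R_E_lt σ p s t i hp).1 hi
    rcases Bool.eq_or_eq_not t s with rfl | rfl
    · exact h1 _ a
    · have := h2 _ a
      simp at b
      omega
  · exact ⟨R_sign hi (R_E_at σ p s), rfl⟩
  · exfalso
    obtain ⟨j, rfl⟩ : ∃ j, i = j + 1 := ⟨i - 1, by omega⟩
    obtain ⟨a, b⟩ := (R_E_gt σ p s t j (by omega)).1 hi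
    rcases Bool.eq_or_eq_not t s with rfl | rfl
    · exact h1 _ a
    · have := h2 _ a
      simp at b
      omega

open Classical in
lemma card_good (m : ℕ) : (oneViol (m+1)).card =
    (Finset.univ.filter fun t : Equiv.Perm (Fin m) × Fin m × Bool =>
      Good t.1 t.2.1 t.2.2).card := by
  symm
  refine Finset.card_bij (fun t _ => E t.1 t.2.1 t.2.2) ?_ ?_ ?_
  · rintro ⟨σ, p, s⟩ h
    simp only [Finset.mem_filter, Finset.mem_univ, true_and] at h
    exact (mem_oneViol _).2 ⟨_, _, C_of_good σ p s h⟩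
  · rintro ⟨σ, p, s⟩ h ⟨τ, q, t⟩ h' he
    simp only [Finset.mem_filter, Finset.mem_univ, true_and] at h h' he
    have hC := C_of_good σ p s h
    have hR := R_E_at τ q t
    rw [← he] at hR
    obtain rfl := Fin.ext (hC.2 _ _ hR).2
    obtain ⟨rfl, rfl⟩ := E_inj he
    rfl
  · intro π h
    obtain ⟨s, p, hC⟩ := (mem_oneViol _).1 h
    have hp := R_lt hC.1
    obtain ⟨σ, rfl⟩ := E_surj π s p (by omega) hC.1
    refine ⟨(σ, ⟨p, by omega⟩, s), ?_, rfl⟩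
    simp only [Finset.mem_filter, Finset.mem_univ, true_and]
    exact good_of_C σ _ s h

lemma C_unique {m : ℕ} {σ : Equiv.Perm (Fin m)} {s t : Bool} {p q : ℕ}
    (h : C σ s p) (h' : C σ t q) : s = t ∧ p = q := h'.2 _ _ h.1

open Classical in
/-- marking the unique violation at its left end -/
lemma card_left (m : ℕ) :
    (Finset.univ.filter fun t : Equiv.Perm (Fin m) × Fin m × Bool =>
      C t.1 (!t.2.2) t.2.1).card = (oneViol m).card := by
  refine Finset.card_bij (fun t _ => t.1) ?_ ?_ ?_
  · rintro ⟨σ, p, s⟩ h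
    simp only [Finset.mem_filter, Finset.mem_univ, true_and] at h
    exact (mem_oneViol _).2 ⟨_, _, h⟩
  · rintro ⟨σ, p, s⟩ h ⟨τ, q, t⟩ h' he
    simp only [Finset.mem_filter, Finset.mem_univ, true_and] at h h' he
    subst he
    obtain ⟨h1, h2⟩ := C_unique h h'
    obtain rfl := Fin.ext h2
    simpa using h1
  · intro π h
    obtain ⟨s, p, hC⟩ := (mem_oneViol _).1 h
    have hp := R_lt hC.1
    refine ⟨(π, ⟨p, by omega⟩, !s), ?_, rfl⟩
    simpa using hC

open Classical in
/-- marking the unique violation at its right end -/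
lemma card_right (m : ℕ) :
    (Finset.univ.filter fun t : Equiv.Perm (Fin m) × Fin m × Bool =>
      ∃ i, i + 1 = (t.2.1 : ℕ) ∧ C t.1 (!t.2.2) i).card = (oneViol m).card := by
  refine Finset.card_bij (fun t _ => t.1) ?_ ?_ ?_
  · rintro ⟨σ, p, s⟩ h
    simp only [Finset.mem_filter, Finset.mem_univ, true_and] at h
    obtain ⟨i, _, h⟩ := h
    exact (mem_oneViol _).2 ⟨_, _, h⟩
  · rintro ⟨σ, p, s⟩ h ⟨τ, q, t⟩ h' he
    simp only [Finset.mem_filter, Finset.mem_univ, true_and] at h h' he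
    subst he
    obtain ⟨i, hi, h⟩ := h
    obtain ⟨j, hj, h'⟩ := h'
    obtain ⟨h1, h2⟩ := C_unique h h'
    obtain rfl : p = q := Fin.ext (by omega)
    simpa using h1
  · intro π h
    obtain ⟨s, p, hC⟩ := (mem_oneViol _).1 h
    have hp := R_lt hC.1
    refine ⟨(π, ⟨p + 1, by omega⟩, !s), ?_, rfl⟩
    simpa using hC

/-- Exactly two violations, `p - 1` and `p`, of sign `!s`. -/
def Two {m : ℕ} (σ : Equiv.Perm (Fin m)) (p : ℕ) (s : Bool) : Prop :=
  Good σ p s ∧ R σ (!s) p ∧ ∃ i, i + 1 = p ∧ R σ (!s) i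

lemma two_def {m : ℕ} (σ : Equiv.Perm (Fin m)) (p : ℕ) (s : Bool) :
    Two σ p s ↔ Good σ p s ∧ R σ (!s) p ∧ ∃ i, i + 1 = p ∧ R σ (!s) i := Iff.rfl

lemma two_iff {m : ℕ} (τ : Equiv.Perm (Fin m)) (q : Fin m) (s : Bool) :
    Two (E τ q (!s)) (q + 1) s ↔ C τ (!s) q := by
  constructor
  · rintro ⟨⟨h1, h2⟩, h3, -⟩
    rw [R_E_gt _ _ _ _ _ le_rfl] at h3
    refine ⟨h3.1, fun t i hi => ?_⟩
    rcases lt_trichotomy i (q : ℕ) with hp | rfl | hp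
    · exfalso
      rcases Bool.eq_or_eq_not t s with rfl | rfl
      · have h4 := h1 i
        rw [R_E_lt _ _ _ _ _ hp] at h4
        by_cases hq : i + 1 < q
        · exact h4 ⟨hi, Or.inr hq⟩
        · -- i + 1 = q: up then down by one contradicts injectivity
          have e : (q : ℕ) = i + 1 := by omega
          have h5 := h3.1
          rw [e] at h5
          obtain ⟨a, b⟩ := hi
          obtain ⟨c, d⟩ := h5
          have := val_ne τ i (i+1+1) (by omega) c (by omega)
          cases t <;> simp at b d <;> omega
      · have := h2 i ((R_E_lt _ _ _ _ _ hp).2 ⟨hi, Or.inl rfl⟩)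
        omega
    · exact ⟨R_sign hi h3.1, rfl⟩
    · exfalso
      rcases Bool.eq_or_eq_not t s with rfl | rfl
      · exact h1 (i+1) ((R_E_gt _ _ _ _ _ hp.le).2 ⟨hi, Or.inr hp⟩)
      · have := h2 (i+1) ((R_E_gt _ _ _ _ _ hp.le).2 ⟨hi, Or.inl rfl⟩)
        omega
  · rintro ⟨h1, h2⟩
    have key : ∀ t i, R (E τ q (!s)) t i → t = (!s) ∧ (i = q ∨ i = q + 1) := by
      intro t i hi
      rcases lt_trichotomy i (q : ℕ) with hp | rfl | hp
      · have := (h2 _ _ ((R_E_lt _ _ _ _ _ hp).1 hi).1).2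
        omega
      · exact ⟨R_sign hi (R_E_at _ _ _), Or.inl rfl⟩
      · obtain ⟨j, rfl⟩ : ∃ j, i = j + 1 := ⟨i - 1, by omega⟩
        have := h2 _ _ ((R_E_gt _ _ _ _ _ (by omega)).1 hi).1
        exact ⟨this.1, Or.inr (by omega)⟩
    refine ⟨⟨fun i hi => ?_, fun i hi => ?_⟩, ?_, q, rfl, R_E_at _ _ _⟩
    · have := (key _ _ hi).1
      simp at this
    · have := (key _ _ hi).2
      omega
    · exact (R_E_gt _ _ _ _ _ le_rfl).2 ⟨h1, Or.inl rfl⟩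

open Classical in
lemma card_two (m : ℕ) :
    (Finset.univ.filter fun t : Equiv.Perm (Fin (m+1)) × Fin (m+1) × Bool =>
      Two t.1 t.2.1 t.2.2).card = (oneViol m).card := by
  rw [← card_left]
  symm
  refine Finset.card_bij (fun t _ => (E t.1 t.2.1 (!t.2.2), t.2.1.succ, t.2.2)) ?_ ?_ ?_
  · rintro ⟨σ, p, s⟩ h
    simp only [Finset.mem_filter, Finset.mem_univ, true_and] at h ⊢
    exact (two_iff _ _ _).2 h
  · rintro ⟨σ, p, s⟩ h ⟨τ, q, t⟩ h' he
    simp only [Prod.mk.injEq, Fin.succ_inj] at he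
    obtain ⟨h1, rfl, rfl⟩ := he
    rw [(E_inj h1).1]
  · rintro ⟨π, p, s⟩ h
    simp only [Finset.mem_filter, Finset.mem_univ, true_and] at h
    obtain ⟨q, hq, hR⟩ := id h.2.2
    have hm := R_lt hR
    obtain ⟨σ, rfl⟩ := E_surj π (!s) q (by omega) hR
    have hqm : q < m := by omega
    obtain rfl : p = Fin.succ ⟨q, hqm⟩ := Fin.ext (by simp; omega)
    refine ⟨(σ, ⟨q, by omega⟩, s), ?_, rfl⟩
    simp only [Finset.mem_filter, Finset.mem_univ, true_and]
    exact (two_iff _ _ _).1 h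

open Classical in
lemma card_none (m : ℕ) :
    (Finset.univ.filter fun t : Equiv.Perm (Fin m) × Fin m × Bool =>
      ∀ s i, ¬ R t.1 s i).card = (noViol m).card * (m * 2) := by
  have : (Finset.univ.filter fun t : Equiv.Perm (Fin m) × Fin m × Bool =>
      ∀ s i, ¬ R t.1 s i) = noViol m ×ˢ Finset.univ := by
    ext t
    simp only [Finset.mem_filter, Finset.mem_univ, true_and, Finset.mem_product, and_true,
      mem_noViol]
  rw [this, Finset.card_product]
  simp

lemma split_iff {m : ℕ} (σ : Equiv.Perm (Fin m)) (p : ℕ) (s : Bool) :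
    (Good σ p s ∧ R σ (!s) p ∧ ¬ (∃ i, i + 1 = p ∧ R σ (!s) i) ↔ C σ (!s) p) ∧
    (Good σ p s ∧ ¬ R σ (!s) p ∧ (∃ i, i + 1 = p ∧ R σ (!s) i) ↔
      ∃ i, i + 1 = p ∧ C σ (!s) i) ∧
    (Good σ p s ∧ ¬ R σ (!s) p ∧ ¬ (∃ i, i + 1 = p ∧ R σ (!s) i) ↔ ∀ t i, ¬ R σ t i) := by
  refine ⟨⟨?_, ?_⟩, ⟨?_, ?_⟩, ⟨?_, ?_⟩⟩
  · rintro ⟨⟨h1, h2⟩, h3, h4⟩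
    refine ⟨h3, fun t i hi => ?_⟩
    rcases Bool.eq_or_eq_not t s with rfl | rfl
    · exact absurd hi (h1 i)
    · rcases h2 i hi with h | h
      · exact ⟨rfl, h⟩
      · exact absurd ⟨i, h, hi⟩ h4
  · rintro ⟨h1, h2⟩
    refine ⟨⟨fun i hi => ?_, fun i hi => Or.inl (h2 _ _ hi).2⟩, h1, ?_⟩
    · simpa using (h2 _ _ hi).1
    · rintro ⟨i, hi, hR⟩
      have := (h2 _ _ hR).2
      omega
  · rintro ⟨⟨h1, h2⟩, h3, j, hj, h4⟩
    refine ⟨j, hj, h4, fun t i hi => ?_⟩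
    rcases Bool.eq_or_eq_not t s with rfl | rfl
    · exact absurd hi (h1 i)
    · rcases h2 i hi with rfl | h
      · exact absurd hi h3
      · exact ⟨rfl, by omega⟩
  · rintro ⟨j, hj, h1, h2⟩
    refine ⟨⟨fun i hi => ?_, fun i hi => Or.inr ?_⟩, fun hi => ?_, j, hj, h1⟩
    · simpa using (h2 _ _ hi).1
    · have := (h2 _ _ hi).2
      omega
    · have := (h2 _ _ hi).2
      omega
  · rintro ⟨⟨h1, h2⟩, h3, h4⟩ t i hi
    rcases Bool.eq_or_eq_not t s with rfl | rfl
    · exact h1 i hi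
    · rcases h2 i hi with rfl | h
      · exact h3 hi
      · exact h4 ⟨i, h, hi⟩
  · intro h
    exact ⟨⟨fun i => h _ i, fun i hi => absurd hi (h _ _)⟩, h _ _, fun ⟨i, _, hi⟩ => h _ _ hi⟩

open Classical in
lemma card_split4 {α : Type*} [Fintype α] (G P Q : α → Prop) :
    (Finset.univ.filter G).card = (Finset.univ.filter fun t => G t ∧ P t ∧ Q t).card
      + (Finset.univ.filter fun t => G t ∧ P t ∧ ¬ Q t).card
      + (Finset.univ.filter fun t => G t ∧ ¬ P t ∧ Q t).card
      + (Finset.univ.filter fun t => G t ∧ ¬ P t ∧ ¬ Q t).card := by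
  rw [← Finset.card_filter_add_card_filter_not (s := Finset.univ.filter G) P,
    ← Finset.card_filter_add_card_filter_not (s := (Finset.univ.filter G).filter P) Q,
    ← Finset.card_filter_add_card_filter_not (s := (Finset.univ.filter G).filter fun t => ¬ P t) Q]
  simp only [Finset.filter_filter, and_assoc, add_assoc]

theorem main (m : ℕ) : (oneViol (m+2)).card =
    2 * (m+1) * (noViol (m+1)).card + 2 * (oneViol (m+1)).card + (oneViol m).card := by
  classical
  have h1 := card_good (m+1)
  rw [card_split4 _ (fun t : Equiv.Perm (Fin (m+1)) × Fin (m+1) × Bool => R t.1 (!t.2.2) t.2.1)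
      (fun t : Equiv.Perm (Fin (m+1)) × Fin (m+1) × Bool =>
        ∃ i, i + 1 = (t.2.1 : ℕ) ∧ R t.1 (!t.2.2) i)] at h1
  simp only [← two_def, (split_iff _ _ _).1, (split_iff _ _ _).2.1, (split_iff _ _ _).2.2] at h1
  rw [card_two, card_left, card_right, card_none] at h1
  rw [h1]
  ring

end Lem2

theorem lemma2 (n : ℕ) (hn : 3 ≤ n) :
    (oneViol n).card =
      2 * (n - 1) * (noViol (n - 1)).card + 2 * (oneViol (n - 1)).card
        + (oneViol (n - 2)).card := by
  obtain ⟨m, rfl⟩ : ∃ m, n = m + 2 := ⟨n - 2, by omega⟩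
  exact Lem2.main m
end

section
/- For all positive integers r, s and n, the number b_{r,s}(n) of permutations π of {1,…,n} such that |π_{i+r} − π_i| ≠ s for all 1 ≤ i ≤ n−r equals Σ_α C^{(n,s)}_α · C^{(n,r)}_α · (−1)^{n − (a_1 + a_2 + ⋯ + a_n)} · a_1! · a_2! ⋯ a_n! · 2^{a_2 + a_3 + ⋯ + a_n}, where the sum ranges over all integer partitions α of n, a_m denotes the multiplicity of the part m in α, and C^{(n,r)}_α denotes the number of set partitions of {1,…,n} in which every block is of the form {k, k+r, k+2r, …, k+(m−1)r} for some k and some m ≥ 1, and whose multiset of block sizes equals α. -/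
/-- The set of permutations `π` of `{0,…,n-1}` (equivalently `{1,…,n}`) such that
`|π (i+r) - π i| ≠ s` for all valid indices `i`; its cardinality is `b_{r,s}(n)`. -/
def noAbsShift (r s n : ℕ) : Finset (Equiv.Perm (Fin n)) :=
  Finset.univ.filter fun π =>
    ∀ i j : Fin n, (j : ℕ) = (i : ℕ) + r →
      |((π j : ℕ) : ℤ) - ((π i : ℕ) : ℤ)| ≠ (s : ℤ)

/-- `C^{(n,r)}_α`: the number of set partitions of `{0,…,n-1}` (equivalently `{1,…,n}`)
in which every block is an arithmetic progression with common difference `r`,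
i.e. of the form `{k, k+r, …, k+(m-1)r}` for some `k` and some `m ≥ 1`
(singleton blocks qualify), and whose multiset of block sizes equals the
partition `α` of `n`. -/
noncomputable def tilingCount (n r : ℕ) (α : Nat.Partition n) : ℕ :=
  Nat.card {P : Finpartition (Finset.univ : Finset (Fin n)) //
    (∀ b ∈ P.parts, ∃ k m : ℕ, 1 ≤ m ∧
      b.image (Fin.val) = (Finset.range m).image (fun t => k + t * r)) ∧
    P.parts.val.map Finset.card = α.parts}


/-- Orientation-preserving or reversing identification of two intervals of equal length. -/
def ori {p q : ℕ} (h : p = q) (e : Bool) : Fin p ≃ Fin q :=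
  (finCongr h).trans (if e then Equiv.refl _ else Fin.revPerm)

lemma ori_val_true {p q : ℕ} (h : p = q) (t : Fin p) : ((ori h true t : Fin q) : ℕ) = t := by
  simp [ori]

lemma ori_val_false {p q : ℕ} (h : p = q) (t : Fin p) :
    ((ori h false t : Fin q) : ℕ) = q - 1 - t := by
  simp [ori, Fin.val_rev]; omega

/-- A bijection between disjoint unions of intervals that maps intervals to intervals,
monotonically. -/
def GoodSig {A B : Type*} (a : A → ℕ) (b : B → ℕ)
    (π : (Σ x : A, Fin (a x)) ≃ (Σ y : B, Fin (b y))) : Prop :=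
  ∀ x, ∃ (y : B) (h : a x = b y) (e : Bool), ∀ t, π ⟨x, t⟩ = ⟨y, ori h e t⟩

/-- The bijection attached to a matching of intervals and a choice of orientations. -/
def mkSig {A B : Type*} (a : A → ℕ) (b : B → ℕ)
    (p : {σ : A ≃ B // ∀ x, a x = b (σ x)} × ({x // 2 ≤ a x} → Bool)) :
    (Σ x : A, Fin (a x)) ≃ (Σ y : B, Fin (b y)) :=
  Equiv.sigmaCongr p.1.1 (fun x => ori (p.1.2 x) (if h : 2 ≤ a x then p.2 ⟨x, h⟩ else true))

lemma mkSig_apply {A B : Type*} (a : A → ℕ) (b : B → ℕ)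
    (p : {σ : A ≃ B // ∀ x, a x = b (σ x)} × ({x // 2 ≤ a x} → Bool)) (x : A) (t : Fin (a x)) :
    mkSig a b p ⟨x, t⟩ =
      ⟨p.1.1 x, ori (p.1.2 x) (if h : 2 ≤ a x then p.2 ⟨x, h⟩ else true) t⟩ := rfl

lemma goodSig_card {A B : Type*} [Fintype A] [Fintype B] (a : A → ℕ) (b : B → ℕ)
    (ha : ∀ x, 0 < a x) (hb : ∀ y, 0 < b y) :
    Nat.card {π // GoodSig a b π} =
      Nat.card {σ : A ≃ B // ∀ x, a x = b (σ x)} * 2 ^ (Nat.card {x // 2 ≤ a x}) := by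
  classical
  have hg : ∀ p, GoodSig a b (mkSig a b p) := fun p x => ⟨_, _, _, fun t => mkSig_apply a b p x t⟩
  have hbij : Function.Bijective
      (fun p => (⟨mkSig a b p, hg p⟩ : {π // GoodSig a b π})) := by
    constructor
    · rintro ⟨⟨σ, hσ⟩, ε⟩ ⟨⟨τ, hτ⟩, δ⟩ h
      have h1 := congrArg Subtype.val h
      have h2 : ∀ x t, mkSig a b ⟨⟨σ, hσ⟩, ε⟩ ⟨x, t⟩ = mkSig a b ⟨⟨τ, hτ⟩, δ⟩ ⟨x, t⟩ :=
        fun x t => congrArg (fun e => e ⟨x, t⟩) h1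
      have h3 : σ = τ := by
        ext x
        exact congrArg Sigma.fst (h2 x ⟨0, ha x⟩)
      subst h3
      have h4 : ε = δ := by
        ext ⟨x, hx⟩
        have := h2 x ⟨0, ha x⟩
        rw [mkSig_apply, mkSig_apply] at this
        simp only [hx, dif_pos, Sigma.mk.injEq, heq_eq_eq, true_and] at this
        have := congrArg Fin.val this
        have h5 := hσ x
        cases h6 : ε ⟨x, hx⟩ <;> cases h7 : δ ⟨x, hx⟩ <;>
          simp [h6, h7, ori_val_true, ori_val_false] at this ⊢ <;> omega
      subst h4
      rfl
    · rintro ⟨π, hπ⟩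
      have hπ' := hπ
      choose y h e hy using hπ'
      have hbij : Function.Bijective y := by
        constructor
        · intro x x' hxx
          have h3 : ∃ t', (⟨y x, ori (h x) (e x) ⟨0, ha x⟩⟩ : Σ y : B, Fin (b y)) =
              ⟨y x', ori (h x') (e x') t'⟩ := by
            generalize ori (h x) (e x) ⟨0, ha x⟩ = z
            generalize y x = w at z hxx
            subst hxx
            exact ⟨(ori (h x') (e x')).symm z, by simp⟩
          obtain ⟨t', ht'⟩ := h3
          rw [← hy, ← hy] at ht'
          exact congrArg Sigma.fst (π.injective ht')
        · intro z
          obtain ⟨⟨x, t⟩, hx⟩ := π.surjective ⟨z, ⟨0, hb z⟩⟩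
          refine ⟨x, ?_⟩
          rw [hy] at hx
          exact congrArg Sigma.fst hx
      refine ⟨⟨⟨Equiv.ofBijective y hbij, h⟩, fun x => e x.1⟩, ?_⟩
      apply Subtype.ext
      ext1 ⟨x, t⟩
      rw [mkSig_apply, hy]
      change (⟨y x, ori (h x) (if h : 2 ≤ a x then e x else true) t⟩ : Σ y : B, Fin (b y)) = _
      by_cases hx : 2 ≤ a x
      · simp [hx]
      · simp only [hx, dite_false]
        congr 1
        apply Fin.ext
        have := (ori (h x) true t).2
        have := (ori (h x) (e x) t).2
        have := h x
        omega
  rw [← Nat.card_congr (Equiv.ofBijective _ hbij), Nat.card_prod, Nat.card_fun]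
  simp

lemma matching_card {A B : Type*} [Fintype A] [Fintype B] (a : A → ℕ) (b : B → ℕ) (S : Finset ℕ)
    (hS : ∀ x, a x ∈ S) (hab : Finset.univ.val.map a = Finset.univ.val.map b) :
    Nat.card {σ : A ≃ B // ∀ x, a x = b (σ x)} =
      ∏ m ∈ S, (Multiset.count m (Finset.univ.val.map a)).factorial := by
  classical
  have hc : ∀ {C : Type _} [Fintype C] (c : C → ℕ) (m : ℕ),
      Fintype.card {x // c x = m} = Multiset.count m (Finset.univ.val.map c) := by
    intro C _ c m
    rw [Multiset.count_map, Fintype.card_subtype]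
    simp [Finset.card, eq_comm]
  have hc' : ∀ {C : Type _} [Fintype C] (c : C → ℕ) (m : ℕ),
      Fintype.card {x // c x = m} = Multiset.count m (Finset.univ.val.map c) := by
    intro C _ c m
    rw [Multiset.count_map, Fintype.card_subtype]
    simp [Finset.card, eq_comm]
  have e : ∀ m, Nonempty ({x // a x = m} ≃ {y // b y = m}) := fun m =>
    ⟨Fintype.equivOfCardEq (by rw [hc, hc', hab])⟩
  let σ₀ : A ≃ B := Equiv.ofFiberEquiv (fun m => (e m).some)
  have hσ₀ : ∀ x, b (σ₀ x) = a x := Equiv.ofFiberEquiv_map _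
  have hσ₀' : ∀ y, a (σ₀.symm y) = b y := fun y => by rw [← hσ₀]; simp
  have E : {σ : A ≃ B // ∀ x, a x = b (σ x)} ≃ {g : Equiv.Perm A // a ∘ g = a} :=
    Equiv.subtypeEquiv (Equiv.equivCongr (Equiv.refl A) σ₀.symm) (fun σ => by
      simp [funext_iff, hσ₀', eq_comm])
  rw [Nat.card_congr E, Nat.card_eq_fintype_card, DomMulAct.stabilizer_card']
  simp only [hc]
  apply Finset.prod_subset
  · intro m; simp; rintro x rfl; exact hS x
  · intro m _ hm
    rw [Multiset.count_eq_zero_of_notMem]; · rfl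
    simpa using hm

/-- All blocks are arithmetic progressions with difference `r`. -/
def IsTil (n r : ℕ) (P : Finpartition (Finset.univ : Finset (Fin n))) : Prop :=
  ∀ b ∈ P.parts, ∃ k m : ℕ, 1 ≤ m ∧
      b.image (Fin.val) = (Finset.range m).image (fun t => k + t * r)

lemma til_coords {n r : ℕ} (hr : 0 < r) {P : Finpartition (Finset.univ : Finset (Fin n))}
    (hP : IsTil n r P) :
    ∃ (u : (Σ x : {x // x ∈ P.parts}, Fin x.1.card) ≃ Fin n) (k : {x // x ∈ P.parts} → ℕ),
      (∀ x t, u ⟨x, t⟩ ∈ x.1) ∧ ∀ x t, (u ⟨x, t⟩ : ℕ) = k x + t * r := by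
  have h1 : ∀ x : {x // x ∈ P.parts}, ∃ k : ℕ,
      x.1.image (Fin.val) = (Finset.range x.1.card).image (fun t => k + t * r) := by
    rintro ⟨x, hx⟩
    obtain ⟨k, m, _, h⟩ := hP x hx
    have h2 := congrArg Finset.card h
    rw [Finset.card_image_of_injective _ Fin.val_injective, Finset.card_image_of_injective,
      Finset.card_range] at h2
    · exact ⟨k, by rw [h, h2]⟩
    · intro s t hst
      simp at hst
      omega
  choose k hk using h1
  have h2 : ∀ (x : {x // x ∈ P.parts}) (t : Fin x.1.card), ∃ i ∈ x.1, (i : ℕ) = k x + t * r := by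
    intro x t
    have : k x + t * r ∈ x.1.image (Fin.val) := by
      rw [hk, Finset.mem_image]
      exact ⟨t, by simp, rfl⟩
    simpa using this
  choose f hf hf' using h2
  have hbij : Function.Bijective
      (fun p : (Σ x : {x // x ∈ P.parts}, Fin x.1.card) => f p.1 p.2) := by
    constructor
    · rintro ⟨x, t⟩ ⟨x', t'⟩ h
      simp only at h
      have hx : x = x' := Subtype.ext (P.eq_of_mem_parts x.2 x'.2 (hf x t) (h ▸ hf x' t'))
      subst hx
      have h3 := hf' x t
      have h4 := hf' x t'
      rw [h, h4] at h3
      have : (t : ℕ) = t' := by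
        have : (t : ℕ) * r = t' * r := by omega
        exact Nat.eq_of_mul_eq_mul_right hr this
      rw [Fin.ext this]
    · intro i
      obtain ⟨x, hx, hi⟩ := P.exists_mem (Finset.mem_univ i)
      have : (i : ℕ) ∈ x.image Fin.val := Finset.mem_image_of_mem _ hi
      rw [hk ⟨x, hx⟩] at this
      simp only [Finset.mem_image, Finset.mem_range] at this
      obtain ⟨t, ht, ht'⟩ := this
      exact ⟨⟨⟨x, hx⟩, ⟨t, ht⟩⟩, Fin.ext (by rw [hf']; exact ht')⟩
  refine ⟨Equiv.ofBijective _ hbij, k, hf, ?_⟩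
  intro x t
  exact hf' x t

/-- Tilings of `{0,…,n-1}`. -/
abbrev Til (n r : ℕ) := {P : Finpartition (Finset.univ : Finset (Fin n)) // IsTil n r P}

/-- The coordinates on a tiling. -/
noncomputable def cu {n r : ℕ} (hr : 0 < r) (P : Til n r) :
    (Σ x : {x // x ∈ P.1.parts}, Fin x.1.card) ≃ Fin n := (til_coords hr P.2).choose

/-- The start of a tile. -/
noncomputable def ck {n r : ℕ} (hr : 0 < r) (P : Til n r) : {x // x ∈ P.1.parts} → ℕ :=
  (til_coords hr P.2).choose_spec.choose

lemma cu_mem {n r : ℕ} (hr : 0 < r) (P : Til n r) (x t) : cu hr P ⟨x, t⟩ ∈ x.1 :=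
  (til_coords hr P.2).choose_spec.choose_spec.1 x t

lemma cu_val {n r : ℕ} (hr : 0 < r) (P : Til n r) (x t) :
    (cu hr P ⟨x, t⟩ : ℕ) = ck hr P x + t * r :=
  (til_coords hr P.2).choose_spec.choose_spec.2 x t

lemma cu_eq {n r : ℕ} (hr : 0 < r) (P : Til n r) {x : Finset (Fin n)} (hx : x ∈ P.1.parts)
    {i : Fin n} (hi : i ∈ x) : ∃ t, i = cu hr P ⟨⟨x, hx⟩, t⟩ := by
  obtain ⟨⟨y, t⟩, hy⟩ := (cu hr P).surjective i
  have h := cu_mem hr P y t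
  rw [hy] at h
  have : y = ⟨x, hx⟩ := Subtype.ext (P.1.eq_of_mem_parts y.2 hx h hi)
  subst this
  exact ⟨t, hy.symm⟩

/-- Left endpoints of links. -/
noncomputable def links {n : ℕ} (r : ℕ) (P : Finpartition (Finset.univ : Finset (Fin n))) :
    Finset (Fin n) :=
  open Classical in Finset.univ.filter
    (fun i => ∃ b ∈ P.parts, i ∈ b ∧ ∃ j ∈ b, (j : ℕ) = i + r)

lemma mem_links {n r : ℕ} {P : Finpartition (Finset.univ : Finset (Fin n))} {i : Fin n} :
    i ∈ links r P ↔ ∃ b ∈ P.parts, i ∈ b ∧ ∃ j ∈ b, (j : ℕ) = i + r := by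
  simp [links]

lemma cu_mem_links {n r : ℕ} (hr : 0 < r) (P : Til n r) (x : {x // x ∈ P.1.parts})
    (t : Fin x.1.card) : cu hr P ⟨x, t⟩ ∈ links r P.1 ↔ (t : ℕ) + 1 < x.1.card := by
  rw [mem_links]
  constructor
  · rintro ⟨b, hb, hi, j, hj, hji⟩
    have : x = ⟨b, hb⟩ := Subtype.ext (P.1.eq_of_mem_parts x.2 hb (cu_mem hr P x t) hi)
    subst this
    obtain ⟨t', rfl⟩ := cu_eq hr P hb hj
    rw [cu_val, cu_val] at hji
    have : (t' : ℕ) * r = (t + 1) * r := by rw [add_mul]; omega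
    have := Nat.eq_of_mul_eq_mul_right hr this
    omega
  · intro h
    refine ⟨x.1, x.2, cu_mem hr P x t, cu hr P ⟨x, ⟨t + 1, h⟩⟩, cu_mem hr P x _, ?_⟩
    rw [cu_val, cu_val]
    simp only
    ring

lemma part_card_pos {n : ℕ} {P : Finpartition (Finset.univ : Finset (Fin n))}
    (x : {x // x ∈ P.parts}) : 0 < x.1.card :=
  Finset.card_pos.2 (P.nonempty_of_mem_parts x.2)

lemma links_card {n r : ℕ} (hr : 0 < r) (P : Til n r) :
    (links r P.1).card = n - P.1.parts.card := by
  classical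
  have h1 : (links r P.1)ᶜ = Finset.univ.image (fun x : {x // x ∈ P.1.parts} =>
      cu hr P ⟨x, ⟨x.1.card - 1, by have := part_card_pos x; omega⟩⟩) := by
    ext i
    obtain ⟨⟨x, t⟩, rfl⟩ := (cu hr P).surjective i
    rw [Finset.mem_compl, cu_mem_links]
    simp only [Finset.mem_image, Finset.mem_univ, true_and, EmbeddingLike.apply_eq_iff_eq]
    have := t.2
    constructor
    · intro h
      refine ⟨x, ?_⟩
      congr 1
      apply Fin.ext
      simp only
      omega
    · rintro ⟨y, hy⟩
      have : y = x := congrArg Sigma.fst hy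
      subst this
      simp only [Sigma.mk.injEq, heq_eq_eq, true_and] at hy
      rw [← hy]
      simp only
      omega
  have h2 := congrArg Finset.card h1
  rw [Finset.card_compl, Finset.card_image_of_injective, Fintype.card_fin, Finset.card_univ,
    Fintype.card_coe] at h2
  · have := Finset.card_le_univ (links r P.1)
    rw [Fintype.card_fin] at this
    omega
  · intro x y hxy
    exact congrArg Sigma.fst ((cu hr P).injective hxy)

lemma links_sub {n r : ℕ} (hr : 0 < r) (P P' : Til n r) (h : links r P.1 = links r P'.1)
    {x : Finset (Fin n)} (hx : x ∈ P.1.parts) : ∃ x' ∈ P'.1.parts, x ⊆ x' := by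
  have h0 : 0 < x.card := part_card_pos ⟨x, hx⟩
  obtain ⟨x', hx', hm⟩ := P'.1.exists_mem (Finset.mem_univ (cu hr P ⟨⟨x, hx⟩, ⟨0, h0⟩⟩))
  refine ⟨x', hx', ?_⟩
  have key : ∀ t (ht : t < x.card), cu hr P ⟨⟨x, hx⟩, ⟨t, ht⟩⟩ ∈ x' := by
    intro t
    induction t with
    | zero => intro _; exact hm
    | succ t ih =>
      intro ht
      have h1 := ih (by omega)
      have h2 : cu hr P ⟨⟨x, hx⟩, ⟨t, Nat.lt_of_succ_lt ht⟩⟩ ∈ links r P.1 := by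
        rw [cu_mem_links]; exact ht
      rw [h, mem_links] at h2
      obtain ⟨b, hb, hib, j, hj, hji⟩ := h2
      have : b = x' := P'.1.eq_of_mem_parts hb hx' hib h1
      subst this
      convert hj
      apply Fin.ext
      rw [hji, cu_val, cu_val]
      simp only
      ring
  intro i hi
  obtain ⟨t, rfl⟩ := cu_eq hr P hx hi
  exact key t t.2

lemma links_inj {n r : ℕ} (hr : 0 < r) (P P' : Til n r) (h : links r P.1 = links r P'.1) :
    P = P' := by
  have key : ∀ (P P' : Til n r) (_ : links r P.1 = links r P'.1), P.1.parts ⊆ P'.1.parts := by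
    intro P P' h x hx
    obtain ⟨x', hx', h1⟩ := links_sub hr P P' h hx
    obtain ⟨x'', hx'', h2⟩ := links_sub hr P' P h.symm hx'
    obtain ⟨i, hi⟩ := P.1.nonempty_of_mem_parts hx
    have : x = x'' := P.1.eq_of_mem_parts hx hx'' hi (h2 (h1 hi))
    subst this
    rwa [Finset.Subset.antisymm h1 h2]
  apply Subtype.ext
  apply Finpartition.ext
  exact Finset.Subset.antisymm (key _ _ h) (key _ _ h.symm)

/-- The equivalence relation generated by a set of links. -/
def linkSetoid {n : ℕ} (r : ℕ) (T : Finset (Fin n)) : Setoid (Fin n) where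
  r i j := (i : ℕ) % r = j % r ∧ ∀ c : Fin n, (c : ℕ) % r = i % r →
    ((i ≤ c ∧ c < j) ∨ (j ≤ c ∧ c < i)) → c ∈ T
  iseqv := by
    refine ⟨?_, ?_, ?_⟩
    · intro i
      exact ⟨rfl, fun c _ h => by omega⟩
    · rintro i j ⟨h1, h2⟩
      exact ⟨h1.symm, fun c hc h => h2 c (hc.trans h1.symm) h.symm⟩
    · rintro i j k ⟨h1, h2⟩ ⟨h3, h4⟩
      refine ⟨h1.trans h3, fun c hc h => ?_⟩
      have h5 := h2 c hc
      have h6 := h4 c (hc.trans h1)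
      by_cases h7 : (i ≤ c ∧ c < j) ∨ (j ≤ c ∧ c < i)
      · exact h5 h7
      · exact h6 (by omega)

lemma mod_sub {r a b : ℕ} (h : a % r = b % r) (hab : a ≤ b) : ∃ t, b = a + t * r := by
  obtain ⟨t, ht⟩ := (Nat.modEq_iff_dvd' hab).1 h
  exact ⟨t, by rw [mul_comm]; omega⟩

lemma links_surj {n r : ℕ} (hr : 0 < r) (T : Finset (Fin n)) (hT : ∀ i ∈ T, (i : ℕ) + r < n) :
    ∃ P : Til n r, links r P.1 = T := by
  classical
  let P := Finpartition.ofSetoid (linkSetoid r T)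
  have hmem : ∀ b ∈ P.parts, ∀ i ∈ b, ∀ j, j ∈ b ↔ linkSetoid r T i j := by
    intro b hb i hi j
    rw [← P.part_eq_of_mem hb hi]
    exact Finpartition.mem_part_ofSetoid_iff_rel
  have hP : IsTil n r P := by
    intro b hb
    have hne := P.nonempty_of_mem_parts hb
    have hk := b.min'_mem hne
    have hM := b.max'_mem hne
    set k := b.min' hne with hkdef
    set M := b.max' hne with hMdef
    have hkM : k ≤ M := b.min'_le _ hM
    obtain ⟨e1, e2⟩ := (hmem b hb k hk M).1 hM
    obtain ⟨d, hd⟩ := mod_sub e1 hkM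
    refine ⟨k, d + 1, by omega, ?_⟩
    ext c
    simp only [Finset.mem_image, Finset.mem_range]
    constructor
    · rintro ⟨j, hj, rfl⟩
      obtain ⟨f1, f2⟩ := (hmem b hb k hk j).1 hj
      have hkj : k ≤ j := b.min'_le _ hj
      have hjM : j ≤ M := b.le_max' _ hj
      obtain ⟨t, ht⟩ := mod_sub f1 hkj
      refine ⟨t, ?_, ht.symm⟩
      by_contra hcon
      have : (d + 1) * r ≤ t * r := Nat.mul_le_mul_right r (by omega)
      rw [add_mul] at this
      have : (j : ℕ) ≤ M := hjM
      omega
    · rintro ⟨t, ht, rfl⟩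
      have : t * r ≤ d * r := Nat.mul_le_mul_right r (by omega)
      have hlt : (k : ℕ) + t * r ≤ M := by omega
      refine ⟨⟨k + t * r, by have := M.2; omega⟩, ?_, rfl⟩
      rw [hmem b hb k hk]
      refine ⟨by simp, ?_⟩
      intro c hc h
      apply e2 c hc
      simp only [Fin.le_def, Fin.lt_def] at h ⊢
      omega
  refine ⟨⟨P, hP⟩, ?_⟩
  ext i
  rw [mem_links]
  constructor
  · rintro ⟨b, hb, hi, j, hj, hji⟩
    obtain ⟨f1, f2⟩ := (hmem b hb i hi j).1 hj
    apply f2 i rfl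
    left
    simp only [Fin.le_def, Fin.lt_def]
    omega
  · intro hi
    obtain ⟨b, hb, hib⟩ := P.exists_mem (Finset.mem_univ i)
    refine ⟨b, hb, hib, ⟨i + r, hT i hi⟩, ?_, rfl⟩
    rw [hmem b hb i hib]
    refine ⟨by simp, ?_⟩
    intro c hc h
    simp only [Fin.le_def, Fin.lt_def] at h
    have hic : i ≤ c := by simp only [Fin.le_def]; omega
    obtain ⟨t, ht⟩ := mod_sub hc.symm hic
    have : t = 0 := by
      by_contra h0
      have : 1 * r ≤ t * r := Nat.mul_le_mul_right r (by omega)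
      omega
    subst this
    have : c = i := Fin.ext (by omega)
    rwa [this]

lemma mono_ap (f : ℕ → ℤ) (m : ℕ) (s : ℤ)
    (hinj : ∀ t t', t < m → t' < m → f t = f t' → t = t')
    (hstep : ∀ t, t + 1 < m → |f (t + 1) - f t| = s) :
    ∃ e : Bool, ∀ t, t < m → f t = f 0 + (if e then 1 else -1) * t * s := by
  by_cases hm : 1 < m
  · have h0 : ∃ e : Bool, f 1 - f 0 = (if e then 1 else -1) * s := by
      have h1 := hstep 0 hm
      rcases abs_choice (f (0 + 1) - f 0) with h | h
      · exact ⟨true, by rw [h1] at h; simp at h ⊢; omega⟩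
      · exact ⟨false, by rw [h1] at h; simp at h ⊢; omega⟩
    obtain ⟨e, he⟩ := h0
    have hs1 : f 1 - f 0 = s ∨ f 1 - f 0 = -s := by
      cases e
      · right; simpa using he
      · left; simpa using he
    have hall : ∀ t, t + 1 < m → f (t + 1) - f t = f 1 - f 0 := by
      intro t
      induction t with
      | zero => intro _; rfl
      | succ t ih =>
        intro ht
        have h1 := ih (by omega)
        have h2 := hstep (t + 1) ht
        have h3 : f (t + 1 + 1) ≠ f t := fun h => by
          have := hinj _ _ ht (by omega) h
          omega
        rcases abs_choice (f (t + 1 + 1) - f (t + 1)) with h | h <;> rw [h2] at h <;> omega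
    refine ⟨e, ?_⟩
    intro t
    induction t with
    | zero => intro _; simp
    | succ t ih =>
      intro ht
      have h1 := ih (by omega)
      have h2 := hall t ht
      push_cast
      linear_combination h1 + h2 + he
  · refine ⟨true, fun t ht => ?_⟩
    have : t = 0 := by omega
    subst this
    simp

/-- Positions at which the permutation has a forbidden difference. -/
noncomputable def bad (r s : ℕ) {n : ℕ} (π : Equiv.Perm (Fin n)) : Finset (Fin n) :=
  open Classical in Finset.univ.filter (fun i => ∃ j : Fin n, (j : ℕ) = i + r ∧
    |((π j : ℕ) : ℤ) - ((π i : ℕ) : ℤ)| = (s : ℤ))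

lemma mem_bad {r s n : ℕ} {π : Equiv.Perm (Fin n)} {i : Fin n} : i ∈ bad r s π ↔
    ∃ j : Fin n, (j : ℕ) = i + r ∧ |((π j : ℕ) : ℤ) - ((π i : ℕ) : ℤ)| = (s : ℤ) := by
  simp [bad]

/-- `π` maps the tiles of `P` monotonically to those of `Q`. -/
def Gd {r s n : ℕ} (hr : 0 < r) (hs : 0 < s) (P : Til n r) (Q : Til n s)
    (π : Equiv.Perm (Fin n)) : Prop :=
  GoodSig (fun x : {x // x ∈ P.1.parts} => x.1.card) (fun x : {x // x ∈ Q.1.parts} => x.1.card)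
    (((cu hr P).trans π).trans (cu hs Q).symm)

lemma gd_iff {r s n : ℕ} (hr : 0 < r) (hs : 0 < s) (P : Til n r) (Q : Til n s)
    (π : Equiv.Perm (Fin n)) : Gd hr hs P Q π ↔
    ∀ x : {x // x ∈ P.1.parts}, ∃ (y : {x // x ∈ Q.1.parts}) (h : x.1.card = y.1.card) (e : Bool),
      ∀ t, π (cu hr P ⟨x, t⟩) = cu hs Q ⟨y, ori h e t⟩ := by
  simp only [Gd, GoodSig, Equiv.trans_apply, Equiv.symm_apply_eq]

lemma gd_links {r s n : ℕ} (hr : 0 < r) (hs : 0 < s) (P : Til n r) (Q : Til n s)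
    (π : Equiv.Perm (Fin n)) (h : Gd hr hs P Q π) : links r P.1 ⊆ bad r s π := by
  intro i hi
  obtain ⟨⟨x, t⟩, rfl⟩ := (cu hr P).surjective i
  rw [cu_mem_links] at hi
  obtain ⟨y, hxy, e, he⟩ := (gd_iff hr hs P Q π).1 h x
  rw [mem_bad]
  refine ⟨cu hr P ⟨x, ⟨t + 1, hi⟩⟩, ?_, ?_⟩
  · rw [cu_val, cu_val]; simp only; ring
  · rw [he, he, cu_val, cu_val]
    cases e
    · rw [ori_val_false, ori_val_false]
      simp only
      obtain ⟨w, hw⟩ : ∃ w, y.1.card - 1 - (t : ℕ) = w + 1 := ⟨y.1.card - 2 - t, by omega⟩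
      have hw' : y.1.card - 1 - ((t : ℕ) + 1) = w := by omega
      rw [hw, hw']
      push_cast
      rw [show (ck hs Q y + w * s - (ck hs Q y + (w + 1) * s) : ℤ) = -s by ring]
      simp
    · rw [ori_val_true, ori_val_true]
      push_cast
      rw [show (ck hs Q y + (t + 1) * s - (ck hs Q y + t * s) : ℤ) = s by ring]
      simp

lemma gd_parts {r s n : ℕ} (hr : 0 < r) (hs : 0 < s) (P : Til n r) (Q : Til n s)
    (π : Equiv.Perm (Fin n)) (h : Gd hr hs P Q π) :
    Q.1.parts = P.1.parts.image (fun x => x.image π) := by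
  have h1 : ∀ x ∈ P.1.parts, x.image π ∈ Q.1.parts := by
    intro x hx
    obtain ⟨y, hxy, e, he⟩ := (gd_iff hr hs P Q π).1 h ⟨x, hx⟩
    have : x.image π = y.1 := by
      apply Finset.eq_of_subset_of_card_le
      · intro j hj
        obtain ⟨i, hi, rfl⟩ := Finset.mem_image.1 hj
        obtain ⟨t, rfl⟩ := cu_eq hr P hx hi
        rw [he]
        exact cu_mem _ _ _ _
      · rw [Finset.card_image_of_injective _ π.injective]
        exact hxy.ge
    rw [this]
    exact y.2
  ext y
  rw [Finset.mem_image]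
  constructor
  · intro hy
    obtain ⟨j, hj⟩ := Q.1.nonempty_of_mem_parts hy
    obtain ⟨x, hx, hi⟩ := P.1.exists_mem (Finset.mem_univ (π.symm j))
    refine ⟨x, hx, ?_⟩
    apply Q.1.eq_of_mem_parts (h1 x hx) hy _ hj
    exact Finset.mem_image.2 ⟨_, hi, by simp⟩
  · rintro ⟨x, hx, rfl⟩
    exact h1 x hx

lemma gd_unique {r s n : ℕ} (hr : 0 < r) (hs : 0 < s) (P : Til n r) (Q Q' : Til n s)
    (π : Equiv.Perm (Fin n)) (h : Gd hr hs P Q π) (h' : Gd hr hs P Q' π) : Q = Q' :=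
  Subtype.ext (Finpartition.ext (by rw [gd_parts hr hs P Q π h, gd_parts hr hs P Q' π h']))

lemma block_ap {r s n : ℕ} (hr : 0 < r) (P : Til n r)
    (π : Equiv.Perm (Fin n)) (h : links r P.1 ⊆ bad r s π) (x : {x // x ∈ P.1.parts}) :
    ∃ (k : ℕ) (e : Bool), ∀ t : Fin x.1.card,
      (π (cu hr P ⟨x, t⟩) : ℕ) = k + (ori rfl e t : Fin x.1.card) * s := by
  have hpos := part_card_pos x
  obtain ⟨e, he⟩ := mono_ap
    (fun t => if ht : t < x.1.card then ((π (cu hr P ⟨x, ⟨t, ht⟩⟩) : ℕ) : ℤ) else 0)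
    x.1.card s (by
      intro t t' ht ht' heq
      simp only [ht, ht', dite_true] at heq
      have := π.injective (Fin.ext (Nat.cast_injective heq))
      have := (cu hr P).injective this
      simpa using this) (by
      intro t ht
      have ht' : t < x.1.card := by omega
      simp only [ht, ht', dite_true]
      have h1 := h ((cu_mem_links hr P x ⟨t, ht'⟩).2 ht)
      obtain ⟨j, hj, hj'⟩ := mem_bad.1 h1
      have : j = cu hr P ⟨x, ⟨t + 1, ht⟩⟩ := by
        apply Fin.ext
        rw [hj, cu_val, cu_val]
        simp only
        ring
      rwa [this] at hj')
  cases e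
  · refine ⟨π (cu hr P ⟨x, ⟨x.1.card - 1, by omega⟩⟩), false, fun t => ?_⟩
    have h1 := he t t.2
    have h2 := he (x.1.card - 1) (by omega)
    have h3 : x.1.card - 1 < x.1.card := by omega
    simp only [t.2, h3, hpos, dite_true] at h1 h2
    rw [ori_val_false]
    zify
    rw [h1, h2]
    have := t.2
    rw [Nat.cast_sub (show (t : ℕ) ≤ x.1.card - 1 by omega)]
    simp
    ring
  · refine ⟨π (cu hr P ⟨x, ⟨0, hpos⟩⟩), true, fun t => ?_⟩
    have h1 := he t t.2
    simp only [t.2, hpos, dite_true] at h1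
    rw [ori_val_true]
    zify
    rw [h1]
    simp

lemma gd_exists {r s n : ℕ} (hr : 0 < r) (hs : 0 < s) (P : Til n r)
    (π : Equiv.Perm (Fin n)) (h : links r P.1 ⊆ bad r s π) : ∃ Q : Til n s, Gd hr hs P Q π := by
  classical
  choose k e hke using block_ap (s := s) hr P π h
  have hinj : Function.Injective (fun x : Finset (Fin n) => x.image π) :=
    Finset.image_injective π.injective
  let Q : Finpartition (Finset.univ : Finset (Fin n)) :=
    Finpartition.ofExistsUnique (P.1.parts.image (fun x => x.image π))
      (fun _ _ => Finset.subset_univ _)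
      (by
        intro j _
        obtain ⟨x, hx, hi⟩ := P.1.exists_mem (Finset.mem_univ (π.symm j))
        refine ⟨x.image π, ⟨Finset.mem_image_of_mem _ hx,
          Finset.mem_image.2 ⟨_, hi, by simp⟩⟩, ?_⟩
        rintro y ⟨hy, hjy⟩
        obtain ⟨x', hx', rfl⟩ := Finset.mem_image.1 hy
        obtain ⟨i', hi', rfl⟩ := Finset.mem_image.1 hjy
        simp only [Equiv.symm_apply_apply] at hi
        rw [P.1.eq_of_mem_parts hx hx' hi hi'])
      (by
        intro h0
        obtain ⟨x, hx, hx0⟩ := Finset.mem_image.1 h0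
        rw [Finset.image_eq_empty] at hx0
        exact P.1.ne_empty hx hx0)
  have himg : ∀ x : {x // x ∈ P.1.parts}, (x.1.image π).image Fin.val =
      (Finset.range x.1.card).image (fun t => k x + t * s) := by
    intro x
    ext c
    simp only [Finset.mem_image, Finset.mem_range, exists_exists_and_eq_and]
    constructor
    · rintro ⟨i, hi, rfl⟩
      obtain ⟨t, rfl⟩ := cu_eq hr P x.2 hi
      exact ⟨_, (ori rfl (e x) t).2, (hke x t).symm⟩
    · rintro ⟨t, ht, rfl⟩
      refine ⟨cu hr P ⟨x, (ori rfl (e x)).symm ⟨t, ht⟩⟩, cu_mem _ _ _ _, ?_⟩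
      rw [hke]
      simp
  have hQ : IsTil n s Q := by
    intro y hy
    obtain ⟨x, hx, rfl⟩ := Finset.mem_image.1 hy
    exact ⟨k ⟨x, hx⟩, x.card, part_card_pos ⟨x, hx⟩, himg ⟨x, hx⟩⟩
  refine ⟨⟨Q, hQ⟩, (gd_iff _ _ _ _ _).2 ?_⟩
  intro x
  have hy : x.1.image π ∈ Q.parts := Finset.mem_image_of_mem _ x.2
  have hcard : x.1.card = (x.1.image π).card := (Finset.card_image_of_injective _ π.injective).symm
  have hk : ck hs ⟨Q, hQ⟩ ⟨x.1.image π, hy⟩ = k x := by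
    have hpos := part_card_pos x
    apply le_antisymm
    · have h1 : k x ∈ (x.1.image π).image Fin.val := by
        rw [himg]
        exact Finset.mem_image.2 ⟨0, by simpa using hpos, by simp⟩
      obtain ⟨j, hj, hjk⟩ := Finset.mem_image.1 h1
      obtain ⟨t, rfl⟩ := cu_eq hs ⟨Q, hQ⟩ hy hj
      rw [cu_val] at hjk
      omega
    · have h1 := cu_mem hs ⟨Q, hQ⟩ ⟨x.1.image π, hy⟩ ⟨0, hcard ▸ hpos⟩
      have h2 := Finset.mem_image_of_mem Fin.val h1
      rw [himg, cu_val] at h2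
      obtain ⟨t, _, ht⟩ := Finset.mem_image.1 h2
      simp at ht
      omega
  refine ⟨⟨x.1.image π, hy⟩, hcard, e x, fun t => ?_⟩
  apply Fin.ext
  rw [hke, cu_val, hk]
  congr 2
  cases e x
  · rw [ori_val_false, ori_val_false, ← hcard]
  · rw [ori_val_true, ori_val_true]

/-- Weight of a multiset of block sizes. -/
def wt (n : ℕ) (M : Multiset ℕ) : ℤ :=
  (-1) ^ (n - M.card) * (∏ m ∈ Finset.Icc 1 n, ((Multiset.count m M).factorial : ℤ))
    * 2 ^ (∑ m ∈ Finset.Icc 2 n, Multiset.count m M)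

/-- Block sizes. -/
def typ {n : ℕ} (P : Finpartition (Finset.univ : Finset (Fin n))) : Multiset ℕ :=
  P.parts.val.map Finset.card

lemma typ_eq {n : ℕ} (P : Finpartition (Finset.univ : Finset (Fin n))) :
    (Finset.univ : Finset {x // x ∈ P.parts}).val.map (fun x => x.1.card) = typ P := by
  rw [typ, Finset.univ_eq_attach, Finset.attach_val]
  exact Multiset.attach_map_val' P.parts.val Finset.card

/-- The partition of `n` given by the block sizes. -/
def typP {n : ℕ} (P : Finpartition (Finset.univ : Finset (Fin n))) : Nat.Partition n where
  parts := typ P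
  parts_pos := by
    intro i hi
    obtain ⟨x, hx, rfl⟩ := Multiset.mem_map.1 hi
    exact part_card_pos ⟨x, hx⟩
  parts_sum := by
    have := P.sum_card_parts
    rw [Finset.card_univ, Fintype.card_fin] at this
    exact this

lemma gd_card {r s n : ℕ} (hr : 0 < r) (hs : 0 < s) (P : Til n r) (Q : Til n s) :
    (-1 : ℤ) ^ (links r P.1).card * (Nat.card {π // Gd hr hs P Q π} : ℤ) =
      if typ P.1 = typ Q.1 then wt n (typ P.1) else 0 := by
  classical
  have E : {π // Gd hr hs P Q π} ≃ {π // GoodSig (fun x : {x // x ∈ P.1.parts} => x.1.card)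
      (fun x : {x // x ∈ Q.1.parts} => x.1.card) π} :=
    Equiv.subtypeEquiv (Equiv.equivCongr (cu hr P).symm (cu hs Q).symm) (fun π => Iff.rfl)
  rw [Nat.card_congr E, goodSig_card _ _ part_card_pos part_card_pos]
  split_ifs with h
  · rw [matching_card (fun x : {x // x ∈ P.1.parts} => x.1.card)
      (fun x : {x // x ∈ Q.1.parts} => x.1.card) (Finset.Icc 1 n), typ_eq, wt, links_card hr]
    · have h2 : Nat.card {x : {x // x ∈ P.1.parts} // 2 ≤ x.1.card} =
          ∑ m ∈ Finset.Icc 2 n, Multiset.count m (typ P.1) := by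
        have h3 : ∀ m, Multiset.count m (typ P.1) =
            (Finset.univ.filter (fun x : {x // x ∈ P.1.parts} => x.1.card = m)).card := by
          intro m
          rw [← typ_eq, Multiset.count_map]
          change (Finset.univ.filter (fun x : {x // x ∈ P.1.parts} => m = x.1.card)).card = _
          simp only [eq_comm]
        simp only [h3]
        rw [Nat.card_eq_fintype_card, Fintype.card_subtype]
        rw [Finset.card_eq_sum_card_fiberwise (f := fun x => x.1.card) (t := Finset.Icc 2 n)]
        · apply Finset.sum_congr rfl
          intro m hm
          congr 1
          ext x
          simp at hm ⊢
          omega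
        · intro x hx
          have := Finset.card_le_univ x.1
          simp at this hx ⊢
          omega
      rw [h2]
      push_cast
      rw [typ, Multiset.card_map, Finset.card_val]
      ring
    · intro x
      have := Finset.card_le_univ x.1
      have := part_card_pos x
      simp at this ⊢
      simp_all
    · rw [typ_eq, typ_eq, h]
  · have : IsEmpty {σ : {x // x ∈ P.1.parts} ≃ {x // x ∈ Q.1.parts} //
        ∀ x, x.1.card = (σ x).1.card} := by
      refine ⟨fun ⟨σ, hσ⟩ => h ?_⟩
      rw [← typ_eq, ← typ_eq]
      have h1 : (Finset.univ : Finset {x // x ∈ Q.1.parts}) = Finset.univ.map σ.toEmbedding :=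
        (Finset.map_univ_equiv σ).symm
      rw [h1, Finset.map_val, Multiset.map_map]
      apply Multiset.map_congr rfl
      intro x _
      exact hσ x
    rw [Nat.card_of_isEmpty]
    simp

noncomputable instance tilFintype (n r : ℕ) : Fintype (Til n r) := Fintype.ofFinite _

lemma card_expand {r s n : ℕ} (hr : 0 < r) (hs : 0 < s) :
    ((noAbsShift r s n).card : ℤ) =
      ∑ P : Til n r, ∑ Q : Til n s, if typ P.1 = typ Q.1 then wt n (typ P.1) else 0 := by
  classical
  have h1 : ∀ π : Equiv.Perm (Fin n), (if π ∈ noAbsShift r s n then (1 : ℤ) else 0) =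
      ∑ P : Til n r, ∑ Q : Til n s,
        if Gd hr hs P Q π then (-1 : ℤ) ^ (links r P.1).card else 0 := by
    intro π
    have h2 : π ∈ noAbsShift r s n ↔ bad r s π = ∅ := by
      rw [noAbsShift, Finset.mem_filter, Finset.eq_empty_iff_forall_notMem]
      simp only [mem_bad, Finset.mem_univ, true_and, not_exists, not_and]
    have h3 : ∀ P : Til n r, (∑ Q : Til n s,
        if Gd hr hs P Q π then (-1 : ℤ) ^ (links r P.1).card else 0) =
        if links r P.1 ⊆ bad r s π then (-1 : ℤ) ^ (links r P.1).card else 0 := by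
      intro P
      split_ifs with h
      · obtain ⟨Q, hQ⟩ := gd_exists hr hs P π h
        rw [Finset.sum_eq_single Q]
        · rw [if_pos hQ]
        · intro Q' _ hne
          rw [if_neg]
          exact fun h' => hne (gd_unique hr hs P _ _ π h' hQ)
        · simp
      · apply Finset.sum_eq_zero
        intro Q _
        rw [if_neg]
        exact fun h' => h (gd_links hr hs P Q π h')
    simp only [h3, h2]
    rw [← Finset.sum_powerset_neg_one_pow_card, ← Finset.sum_filter]
    symm
    apply Finset.sum_bij (fun (P : Til n r) _ => links r P.1)
    · intro P hP
      simpa using hP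
    · intro P _ P' _ h
      exact links_inj hr P P' h
    · intro T hT
      rw [Finset.mem_powerset] at hT
      obtain ⟨P, hP⟩ := links_surj hr T (fun i hi => by
        obtain ⟨j, hj, _⟩ := mem_bad.1 (hT hi)
        rw [← hj]; exact j.2)
      exact ⟨P, by simpa [hP] using hT, hP⟩
    · intros; rfl
  have h4 : ((noAbsShift r s n).card : ℤ) =
      ∑ π : Equiv.Perm (Fin n), if π ∈ noAbsShift r s n then (1 : ℤ) else 0 := by
    simp
  rw [h4]
  simp only [h1]
  rw [Finset.sum_comm]
  apply Finset.sum_congr rfl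
  intro P _
  rw [Finset.sum_comm]
  apply Finset.sum_congr rfl
  intro Q _
  rw [← gd_card hr hs P Q, Nat.card_eq_fintype_card, Fintype.card_subtype, ← Finset.sum_filter,
    Finset.sum_const, nsmul_eq_mul, mul_comm]

lemma tilingCount_eq (n r : ℕ) (α : Nat.Partition n) :
    (tilingCount n r α : ℤ) = ∑ P : Til n r, if typP P.1 = α then (1 : ℤ) else 0 := by
  classical
  have E : {P : Finpartition (Finset.univ : Finset (Fin n)) //
      (∀ b ∈ P.parts, ∃ k m : ℕ, 1 ≤ m ∧
        b.image (Fin.val) = (Finset.range m).image (fun t => k + t * r)) ∧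
      P.parts.val.map Finset.card = α.parts} ≃ {P : Til n r // typP P.1 = α} :=
    (Equiv.subtypeSubtypeEquivSubtypeInter (IsTil n r)
      (fun P => P.parts.val.map Finset.card = α.parts)).symm.trans
      (Equiv.subtypeEquivRight (fun P => (Nat.Partition.ext_iff (x := typP P.1) (y := α)).symm))
  rw [tilingCount, Nat.card_congr E, Nat.card_eq_fintype_card, Fintype.card_subtype]
  simp

/-- For all positive `r`, `s`, `n`:
`b_{r,s}(n) = Σ_α C^{(n,s)}_α · C^{(n,r)}_α · (-1)^{n-(a_1+⋯+a_n)} · a_1!·a_2!⋯a_n! · 2^{a_2+⋯+a_n}`,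
where `α` ranges over the partitions of `n` and `a_m` is the multiplicity of the
part `m` in `α` (so that `a_1 + ⋯ + a_n` is the number of parts of `α`). -/
theorem noAbsShift_card_eq (r s n : ℕ) (hr : 0 < r) (hs : 0 < s) (hn : 0 < n) :
    ((noAbsShift r s n).card : ℤ) =
      ∑ α : Nat.Partition n,
        (tilingCount n s α : ℤ) * (tilingCount n r α : ℤ)
          * (-1) ^ (n - α.parts.card)
          * (∏ m ∈ Finset.Icc 1 n, ((Multiset.count m α.parts).factorial : ℤ))
          * 2 ^ (∑ m ∈ Finset.Icc 2 n, Multiset.count m α.parts) := by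
  classical
  rw [card_expand hr hs]
  have h1 : ∀ α : Nat.Partition n, (tilingCount n s α : ℤ) * (tilingCount n r α : ℤ)
          * (-1) ^ (n - α.parts.card)
          * (∏ m ∈ Finset.Icc 1 n, ((Multiset.count m α.parts).factorial : ℤ))
          * 2 ^ (∑ m ∈ Finset.Icc 2 n, Multiset.count m α.parts) =
      ∑ P : Til n r, ∑ Q : Til n s,
        if typP P.1 = α then (if typP Q.1 = α then wt n α.parts else 0) else 0 := by
    intro α
    rw [mul_assoc, mul_assoc, ← mul_assoc ((-1 : ℤ) ^ _)]
    change _ * _ * wt n α.parts = _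
    rw [tilingCount_eq, tilingCount_eq, mul_comm (∑ P : Til n s, _), Finset.sum_mul_sum,
      Finset.sum_mul]
    apply Finset.sum_congr rfl
    intro P _
    rw [Finset.sum_mul]
    apply Finset.sum_congr rfl
    intro Q _
    split_ifs <;> simp
  simp only [h1]
  symm
  rw [Finset.sum_comm]
  apply Finset.sum_congr rfl
  intro P _
  rw [Finset.sum_comm]
  apply Finset.sum_congr rfl
  intro Q _
  rw [Finset.sum_ite_eq]
  simp only [Finset.mem_univ, if_true]
  have : typP Q.1 = typP P.1 ↔ typ P.1 = typ Q.1 := by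
    rw [Nat.Partition.ext_iff, eq_comm]
    rfl
  simp only [this]
  rfl
end
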